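/- arXiv:1807.09485 — 4 statements merged into one kernel-verified Lean document; each statement's English description precedes it below -/
import Mathlib

section
/- No two distinct simplices among the nine simplices Δ_0^1, Δ_1^1, Δ_2^1, Δ_3^1, Δ_0^0, Δ_1^0, Δ_2^0, Δ'_2, Δ'_3 in ℝ³ are unimodularly equivalent; that is, for any two distinct simplices Δ, Δ' from this list there is no unimodular transformation U with U(Δ) = Δ'. -/
open Pointwise

/-- A unimodular transformation of `ℝ^n`: an affine map `x ↦ A·x + b` with
`A ∈ GL_n(ℤ)` and `b ∈ ℤ^n`. -/
def IsUnimodular {n : ℕ} (f : (Fin n → ℝ) → (Fin n → ℝ)) : Prop :=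
  ∃ A : Matrix (Fin n) (Fin n) ℤ, IsUnit A.det ∧ ∃ b : Fin n → ℤ,
    ∀ x, f x = (A.map (Int.cast : ℤ → ℝ)).mulVec x + fun i => (b i : ℝ)

/-- `conv(0, e_1, …, e_i)` in `ℝ^n`, where `e_1, …, e_n` is the standard basis. -/
def baseSimplex (n i : ℕ) : Set (Fin n → ℝ) :=
  convexHull ℝ (insert 0 ((fun j : Fin n => (Pi.single j 1 : Fin n → ℝ)) '' {j | (j : ℕ) < i}))

/-- A half-unimodular simplex: a set `Δ` such that `2Δ` is the image of some
`conv(0, e_1, …, e_i)` under a unimodular transformation. -/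
def IsHalfUnimodular {n : ℕ} (Δ : Set (Fin n → ℝ)) : Prop :=
  ∃ i ≤ n, ∃ f, IsUnimodular f ∧ (2 : ℝ) • Δ = f '' baseSimplex n i

/-- `Δ_i^1 = ½·conv(0, e_1, …, e_i)` in `ℝ^n`. -/
noncomputable def Δone (n i : ℕ) : Set (Fin n → ℝ) := (2⁻¹ : ℝ) • baseSimplex n i

/-- `Δ_i^0 = ½·conv(e_1, …, e_{i+1})` in `ℝ^n`. -/
noncomputable def Δzero (n i : ℕ) : Set (Fin n → ℝ) :=
  (2⁻¹ : ℝ) •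
    convexHull ℝ ((fun j : Fin n => (Pi.single j 1 : Fin n → ℝ)) '' {j | (j : ℕ) < i + 1})

/-- `Δ'_2 = (½,½,0) + ½·conv(0, e_1, e_2)` in `ℝ³`. -/
noncomputable def Δ'two : Set (Fin 3 → ℝ) := (![1/2, 1/2, 0] : Fin 3 → ℝ) +ᵥ Δone 3 2

/-- `Δ'_3 = (½,½,0) + ½·conv(0, e_1, e_2, e_3)` in `ℝ³`. -/
noncomputable def Δ'three : Set (Fin 3 → ℝ) := (![1/2, 1/2, 0] : Fin 3 → ℝ) +ᵥ Δone 3 3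

/-- The nine half-unimodular simplices `Δ_0^1, Δ_1^1, Δ_2^1, Δ_3^1, Δ_0^0, Δ_1^0, Δ_2^0, Δ'_2, Δ'_3`. -/
noncomputable def nineSimplices : Fin 9 → Set (Fin 3 → ℝ) :=
  ![Δone 3 0, Δone 3 1, Δone 3 2, Δone 3 3, Δzero 3 0, Δzero 3 1, Δzero 3 2, Δ'two, Δ'three]

/-- The points of `ℤ^n` inside `ℝ^n`. -/
def latticePoints (n : ℕ) : Set (Fin n → ℝ) :=
  Set.range fun (z : Fin n → ℤ) i => (z i : ℝ)

namespace IsUnimodular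

variable {n : ℕ} {f : (Fin n → ℝ) → (Fin n → ℝ)}

lemma exists_affineMap (hf : IsUnimodular f) :
    ∃ F : (Fin n → ℝ) →ᵃ[ℝ] (Fin n → ℝ), ⇑F = f := by
  obtain ⟨A, -, b, h⟩ := hf
  refine ⟨(A.map (Int.cast : ℤ → ℝ)).mulVecLin.toAffineMap +
    AffineMap.const ℝ _ (fun i => (b i : ℝ)), ?_⟩
  ext1 x
  simp [h]

lemma mapsTo_latticePoints (hf : IsUnimodular f) :
    Set.MapsTo f (latticePoints n) (latticePoints n) := by
  obtain ⟨A, -, b, h⟩ := hf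
  rintro _ ⟨z, rfl⟩
  refine ⟨A.mulVec z + b, ?_⟩
  ext i
  simp [h, Matrix.mulVec, dotProduct]

lemma exists_leftInverse (hf : IsUnimodular f) :
    ∃ g, IsUnimodular g ∧ Function.LeftInverse g f := by
  obtain ⟨A, hA, b, h⟩ := hf
  have key : (A⁻¹.map (Int.cast : ℤ → ℝ)) * A.map (Int.cast : ℤ → ℝ) = 1 := by
    have := congrArg (Int.castRingHom ℝ).mapMatrix (Matrix.nonsing_inv_mul A hA)
    rwa [map_mul, map_one] at this
  refine ⟨_, ⟨A⁻¹, A.isUnit_nonsing_inv_det hA, -A⁻¹.mulVec b, fun x => rfl⟩, fun x => ?_⟩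
  rw [h, Matrix.mulVec_add, Matrix.mulVec_mulVec, key, Matrix.one_mulVec, add_assoc]
  convert add_zero x using 2
  ext i
  simp [Matrix.mulVec, dotProduct]

variable {X Y : Set (Fin n → ℝ)}

lemma exists_symm (hf : IsUnimodular f) (h : f '' X = Y) :
    ∃ g, IsUnimodular g ∧ g '' Y = X := by
  obtain ⟨g, hg, hgf⟩ := hf.exists_leftInverse
  exact ⟨g, hg, by rw [← h, hgf.image_image]⟩

lemma finrank_vectorSpan_image_le (hf : IsUnimodular f) (h : f '' X = Y) :
    Module.finrank ℝ (vectorSpan ℝ Y) ≤ Module.finrank ℝ (vectorSpan ℝ X) := by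
  obtain ⟨F, rfl⟩ := hf.exists_affineMap
  rw [← h, ← AffineMap.map_vectorSpan]
  exact Submodule.finrank_map_le _ _

lemma finrank_vectorSpan_image (hf : IsUnimodular f) (h : f '' X = Y) :
    Module.finrank ℝ (vectorSpan ℝ X) = Module.finrank ℝ (vectorSpan ℝ Y) := by
  obtain ⟨g, hg, hgY⟩ := hf.exists_symm h
  exact le_antisymm (hg.finrank_vectorSpan_image_le hgY) (hf.finrank_vectorSpan_image_le h)

lemma inter_latticePoints_nonempty (hf : IsUnimodular f) (h : f '' X = Y)
    (hX : (X ∩ latticePoints n).Nonempty) : (Y ∩ latticePoints n).Nonempty := by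
  obtain ⟨x, hx, hxl⟩ := hX
  exact ⟨f x, h ▸ Set.mem_image_of_mem f hx, hf.mapsTo_latticePoints hxl⟩

lemma inter_latticePoints_nonempty_iff (hf : IsUnimodular f) (h : f '' X = Y) :
    (X ∩ latticePoints n).Nonempty ↔ (Y ∩ latticePoints n).Nonempty := by
  obtain ⟨g, hg, hgY⟩ := hf.exists_symm h
  exact ⟨hf.inter_latticePoints_nonempty h, hg.inter_latticePoints_nonempty hgY⟩

lemma image_affineSpan (hf : IsUnimodular f) (h : f '' X = Y) :
    f '' (affineSpan ℝ X : Set (Fin n → ℝ)) = affineSpan ℝ Y := by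
  obtain ⟨F, rfl⟩ := hf.exists_affineMap
  rw [← h, ← AffineSubspace.map_span, AffineSubspace.coe_map]

end IsUnimodular

lemma Δone_eq_convexHull (n i : ℕ) : Δone n i = convexHull ℝ
    (insert 0 ((fun j : Fin n => (Pi.single j 2⁻¹ : Fin n → ℝ)) '' {j | (j : ℕ) < i})) := by
  rw [Δone, baseSimplex, ← convexHull_smul, ← Set.image_smul, Set.image_insert_eq, Set.image_image]
  simp [← Pi.single_smul]

lemma Δzero_eq_convexHull (n i : ℕ) : Δzero n i = convexHull ℝ
    ((fun j : Fin n => (Pi.single j 2⁻¹ : Fin n → ℝ)) '' {j | (j : ℕ) < i + 1}) := by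
  rw [Δzero, ← convexHull_smul, ← Set.image_smul, Set.image_image]
  simp [← Pi.single_smul]

/-- The dimensions of the nine simplices. -/
def simplexDim : Fin 9 → ℕ := ![0, 1, 2, 3, 0, 1, 2, 2, 3]

/-- The vertices of the nine simplices. -/
noncomputable def simplexVertices : (j : Fin 9) → Fin (simplexDim j + 1) → Fin 3 → ℝ
  | 0 => (![![0, 0, 0]] : Fin 1 → Fin 3 → ℝ)
  | 1 => (![![0, 0, 0], ![1/2, 0, 0]] : Fin 2 → Fin 3 → ℝ)
  | 2 => (![![0, 0, 0], ![1/2, 0, 0], ![0, 1/2, 0]] : Fin 3 → Fin 3 → ℝ)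
  | 3 => (![![0, 0, 0], ![1/2, 0, 0], ![0, 1/2, 0], ![0, 0, 1/2]] : Fin 4 → Fin 3 → ℝ)
  | 4 => (![![1/2, 0, 0]] : Fin 1 → Fin 3 → ℝ)
  | 5 => (![![1/2, 0, 0], ![0, 1/2, 0]] : Fin 2 → Fin 3 → ℝ)
  | 6 => (![![1/2, 0, 0], ![0, 1/2, 0], ![0, 0, 1/2]] : Fin 3 → Fin 3 → ℝ)
  | 7 => (![![1/2, 1/2, 0], ![1, 1/2, 0], ![1/2, 1, 0]] : Fin 3 → Fin 3 → ℝ)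
  | 8 => (![![1/2, 1/2, 0], ![1, 1/2, 0], ![1/2, 1, 0], ![1/2, 1/2, 1/2]] : Fin 4 → Fin 3 → ℝ)

lemma nineSimplices_eq_convexHull (j : Fin 9) :
    nineSimplices j = convexHull ℝ (Set.range (simplexVertices j)) := by
  fin_cases j <;>
  · simp only [nineSimplices, Δ'two, Δ'three, Δone_eq_convexHull, Δzero_eq_convexHull,
      ← convexHull_vadd]
    refine congrArg (convexHull ℝ) ?_
    ext x
    simp [simplexVertices, simplexDim, funext_iff, Fin.forall_fin_succ, Fin.exists_fin_succ,
      Set.mem_vadd_set_iff_neg_vadd_mem, Matrix.vecHead, Matrix.vecTail] <;> grind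

lemma affineIndependent_of_forall_sum_mul_eq_zero {m n : ℕ} (p : Fin m → Fin n → ℝ)
    (hp : ∀ w : Fin m → ℝ, ∑ i, w i = 0 → (∀ k, ∑ i, w i * p i k = 0) → ∀ i, w i = 0) :
    AffineIndependent ℝ p := by
  rw [affineIndependent_iff_of_fintype]
  intro w hw h
  rw [Finset.weightedVSub_eq_linear_combination _ hw] at h
  exact hp w hw fun k => by simpa using congrFun h k

lemma affineIndependent_simplexVertices (j : Fin 9) :
    AffineIndependent ℝ (simplexVertices j) := by
  fin_cases j <;>
    [apply affineIndependent_of_forall_sum_mul_eq_zero (m := 1);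
      apply affineIndependent_of_forall_sum_mul_eq_zero (m := 2);
      apply affineIndependent_of_forall_sum_mul_eq_zero (m := 3);
      apply affineIndependent_of_forall_sum_mul_eq_zero (m := 4);
      apply affineIndependent_of_forall_sum_mul_eq_zero (m := 1);
      apply affineIndependent_of_forall_sum_mul_eq_zero (m := 2);
      apply affineIndependent_of_forall_sum_mul_eq_zero (m := 3);
      apply affineIndependent_of_forall_sum_mul_eq_zero (m := 3);
      apply affineIndependent_of_forall_sum_mul_eq_zero (m := 4)] <;>
  · intro w hw h
    simp [simplexVertices, Fin.sum_univ_succ, Fin.forall_fin_succ] at hw h ⊢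
    grind

lemma finrank_vectorSpan_nineSimplices (j : Fin 9) :
    Module.finrank ℝ (vectorSpan ℝ (nineSimplices j)) = simplexDim j := by
  rw [nineSimplices_eq_convexHull, ← direction_affineSpan, affineSpan_convexHull,
    direction_affineSpan]
  exact (affineIndependent_simplexVertices j).finrank_vectorSpan (Fintype.card_fin _)

lemma forall_mem_affineSpan_sum_eq {S : Set (Fin 3 → ℝ)} {c : ℝ} (hS : ∀ x ∈ S, ∑ i, x i = c)
    {x : Fin 3 → ℝ} (hx : x ∈ affineSpan ℝ S) : ∑ i, x i = c := by
  refine affineSpan_induction (p := fun x : Fin 3 → ℝ => ∑ i, x i = c) hx hS ?_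
  · intro t u v w hu hv hw
    simp only [Pi.add_apply, vsub_eq_sub, vadd_eq_add, Pi.smul_apply, Pi.sub_apply, smul_eq_mul,
      Finset.sum_add_distrib, ← Finset.mul_sum, Finset.sum_sub_distrib, hu, hv, hw]
    ring

lemma affineSpan_nineSimplices (j : Fin 9) :
    affineSpan ℝ (nineSimplices j) = affineSpan ℝ (Set.range (simplexVertices j)) := by
  rw [nineSimplices_eq_convexHull, affineSpan_convexHull]

lemma sum_ne_half_of_mem_latticePoints {n : ℕ} {x : Fin n → ℝ} (hx : x ∈ latticePoints n) :
    ∑ i, x i ≠ 1 / 2 := by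
  obtain ⟨z, rfl⟩ := hx
  intro (h : ∑ i, (z i : ℝ) = 1 / 2)
  have h2 : 2 * ∑ i, z i = 1 := by
    have : ((2 * ∑ i, z i : ℤ) : ℝ) = 1 := by push_cast; linarith
    exact_mod_cast this
  omega

lemma disjoint_affineSpan_nineSimplices_latticePoints {j : Fin 9}
    (hj : j ∈ ({4, 5, 6} : Finset (Fin 9))) :
    Disjoint (affineSpan ℝ (nineSimplices j) : Set (Fin 3 → ℝ)) (latticePoints 3) := by
  refine Set.disjoint_left.2 fun x hx hxl => sum_ne_half_of_mem_latticePoints hxl ?_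
  rw [affineSpan_nineSimplices] at hx
  refine forall_mem_affineSpan_sum_eq (Set.forall_mem_range.2 ?_) hx
  fin_cases hj <;>
    simp [simplexVertices, simplexDim, Fin.sum_univ_succ, Fin.forall_fin_succ]

lemma zero_mem_nineSimplices {j : Fin 9} (hj : j ≤ 3) : 0 ∈ nineSimplices j := by
  have h (i : ℕ) : 0 ∈ Δone 3 i := by
    rw [Δone_eq_convexHull]
    exact subset_convexHull ℝ _ (Set.mem_insert _ _)
  fin_cases j <;> first | exact h _ | simp at hj

lemma zero_mem_latticePoints (n : ℕ) : 0 ∈ latticePoints n := ⟨0, by ext; simp⟩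

lemma mem_affineSpan_nineSimplices {j : Fin 9} (hj : 7 ≤ j) :
    ![1, 1, 0] ∈ affineSpan ℝ (nineSimplices j) := by
  replace hj : j = 7 ∨ j = 8 := by revert j; decide
  rw [affineSpan_nineSimplices]
  have h (i) : simplexVertices j i ∈ affineSpan ℝ (Set.range (simplexVertices j)) :=
    subset_affineSpan ℝ _ (Set.mem_range_self i)
  convert AffineSubspace.smul_vsub_vadd_mem _ 1 (h 1) (h 0) (h 2) using 1
  ext k
  obtain rfl | rfl := hj <;> fin_cases k <;> simp [simplexVertices]

lemma affineSpan_nineSimplices_inter_latticePoints_nonempty_iff (j : Fin 9) :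
    ((affineSpan ℝ (nineSimplices j) : Set (Fin 3 → ℝ)) ∩ latticePoints 3).Nonempty ↔
      j ∉ ({4, 5, 6} : Finset (Fin 9)) := by
  refine ⟨fun h hj => Set.not_disjoint_iff_nonempty_inter.2 h
    (disjoint_affineSpan_nineSimplices_latticePoints hj), fun hj => ?_⟩
  obtain hj | hj : j ≤ 3 ∨ 7 ≤ j := by revert j; decide
  · exact ⟨0, subset_affineSpan ℝ _ (zero_mem_nineSimplices hj), zero_mem_latticePoints 3⟩
  · refine ⟨_, mem_affineSpan_nineSimplices hj, ![1, 1, 0], ?_⟩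
    ext k
    fin_cases k <;> simp

lemma disjoint_nineSimplices_latticePoints {j : Fin 9} (hj : 7 ≤ j) :
    Disjoint (nineSimplices j) (latticePoints 3) := by
  replace hj : j = 7 ∨ j = 8 := by revert j; decide
  refine Set.disjoint_left.2 ?_
  rintro _ hx ⟨z, rfl⟩
  have hconv : Convex ℝ {x : Fin 3 → ℝ | 1 / 2 ≤ x 0 ∧ 1 / 2 ≤ x 1 ∧ x 0 + x 1 ≤ 3 / 2} := by
    rintro x ⟨hx0, hx1, hx2⟩ y ⟨hy0, hy1, hy2⟩ a b ha hb hab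
    obtain rfl : a = 1 - b := by linarith
    refine ⟨?_, ?_, ?_⟩ <;> simp only [Pi.add_apply, Pi.smul_apply, smul_eq_mul] <;> nlinarith
  rw [nineSimplices_eq_convexHull] at hx
  have hsub : ∀ i, simplexVertices j i ∈
      {x : Fin 3 → ℝ | 1 / 2 ≤ x 0 ∧ 1 / 2 ≤ x 1 ∧ x 0 + x 1 ≤ 3 / 2} := by
    obtain rfl | rfl := hj <;> simp [simplexVertices, simplexDim, Fin.forall_fin_succ] <;> norm_num
  obtain ⟨h0, h1, h2⟩ : (1 / 2 : ℝ) ≤ z 0 ∧ (1 / 2 : ℝ) ≤ z 1 ∧ (z 0 + z 1 : ℝ) ≤ 3 / 2 :=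
    convexHull_min (Set.range_subset_iff.2 hsub) hconv hx
  have h0' : 0 < z 0 := by exact_mod_cast one_half_pos.trans_le h0
  have h1' : 0 < z 1 := by exact_mod_cast one_half_pos.trans_le h1
  have h2' : z 0 + z 1 < 2 := by exact_mod_cast h2.trans_lt (by norm_num : (3 / 2 : ℝ) < 2)
  omega

lemma nineSimplices_inter_latticePoints_nonempty_iff (j : Fin 9) :
    (nineSimplices j ∩ latticePoints 3).Nonempty ↔ j ≤ 3 := by
  refine ⟨fun h => ?_, fun hj => ⟨0, zero_mem_nineSimplices hj, zero_mem_latticePoints 3⟩⟩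
  have h7 : ¬ 7 ≤ j := fun hj =>
    Set.not_disjoint_iff_nonempty_inter.2 h (disjoint_nineSimplices_latticePoints hj)
  have h456 := (affineSpan_nineSimplices_inter_latticePoints_nonempty_iff j).1
    (h.mono (Set.inter_subset_inter_left _ (subset_affineSpan ℝ _)))
  clear h
  revert j
  decide

lemma eq_of_simplexDim_eq : ∀ j j' : Fin 9, simplexDim j = simplexDim j' → (j ≤ 3 ↔ j' ≤ 3) →
    (j ∉ ({4, 5, 6} : Finset (Fin 9)) ↔ j' ∉ ({4, 5, 6} : Finset (Fin 9))) → j = j' := by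
  decide

/-- No two distinct simplices among the nine are unimodularly equivalent. -/
theorem nineSimplices_pairwise_inequivalent (j j' : Fin 9) (hjj' : j ≠ j') :
    ¬ ∃ f, IsUnimodular f ∧ f '' nineSimplices j = nineSimplices j' := by
  rintro ⟨f, hf, h⟩
  have hdim := hf.finrank_vectorSpan_image h
  have hlat := hf.inter_latticePoints_nonempty_iff h
  have hspan := hf.inter_latticePoints_nonempty_iff (hf.image_affineSpan h)
  rw [finrank_vectorSpan_nineSimplices, finrank_vectorSpan_nineSimplices] at hdim
  rw [nineSimplices_inter_latticePoints_nonempty_iff,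
    nineSimplices_inter_latticePoints_nonempty_iff] at hlat
  rw [affineSpan_nineSimplices_inter_latticePoints_nonempty_iff,
    affineSpan_nineSimplices_inter_latticePoints_nonempty_iff] at hspan
  exact hjj' (eq_of_simplexDim_eq j j' hdim hlat hspan)
end

section
/- Every empty tetrahedron in ℝ³ of determinant q (i.e. of volume q/6) is the image under a unimodular transformation of T(p,q) for some integer p with gcd(p,q) = 1. -/
open Pointwise

/-- `T(p,q) = conv{(0,0,0), (1,0,0), (0,0,1), (p,q,1)}` in `ℝ³`. -/
def Tpq (p q : ℤ) : Set (Fin 3 → ℝ) :=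
  convexHull ℝ
    {![0, 0, 0], ![1, 0, 0], ![0, 0, 1], ![(p : ℝ), (q : ℝ), 1]}

/-- An empty tetrahedron: a 3-dimensional lattice simplex in `ℝ³` whose only lattice
points are its four vertices. -/
def IsEmptyTetrahedron (P : Set (Fin 3 → ℝ)) : Prop :=
  ∃ v : Fin 4 → (Fin 3 → ℤ),
    AffineIndependent ℝ (fun t => fun i => ((v t i : ℤ) : ℝ)) ∧
    P = convexHull ℝ (Set.range fun t => fun i => ((v t i : ℤ) : ℝ)) ∧
    ∀ x : Fin 3 → ℤ, (fun i => (x i : ℝ)) ∈ P → ∃ t, x = v t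

/-- The floors `k * x / q` jump from below `j` to at least `j` at a well-defined step `s`. -/
theorem exists_forall_le_iff_le_mul_ediv {q x : ℤ} (hq : 0 < q) (hx : 0 < x) (j : ℤ) :
    ∃ s : ℤ, ∀ k, s ≤ k ↔ j ≤ k * x / q := by
  refine ⟨-(-(j * q) / x), fun k => ?_⟩
  rw [Int.le_ediv_iff_mul_le hq, neg_le, Int.le_ediv_iff_mul_le hx]
  constructor <;> intro h <;> linarith

theorem ediv_add_ediv_le_add_ediv {q : ℤ} (hq : 0 < q) (a b : ℤ) :
    a / q + b / q ≤ (a + b) / q := by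
  rw [Int.le_ediv_iff_mul_le hq, add_mul]
  exact add_le_add (Int.ediv_mul_le a hq.ne') (Int.ediv_mul_le b hq.ne')

theorem mul_ediv_add_sub_mul_ediv {q k x : ℤ} (hq : 0 < q) (h : ¬ q ∣ k * x) :
    k * x / q + (q - k) * x / q = x - 1 := by
  have e1 : (q - k) * x = -(k * x) + q * x := by ring
  have hm : 0 < k * x % q :=
    lt_of_le_of_ne (Int.emod_nonneg _ hq.ne') fun h0 => h (Int.dvd_of_emod_eq_zero h0.symm)
  have hm' := Int.emod_lt_of_pos (k * x) hq
  have hd := Int.mul_ediv_add_emod (k * x) q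
  have e2 : -(k * x) / q = -(k * x / q) - 1 := by
    rw [Int.ediv_eq_iff_of_pos hq]
    constructor <;> nlinarith
  rw [e1, Int.add_mul_ediv_left _ _ hq.ne', e2]
  ring

/-- If the jumps of three floor sequences of total slope `1 + 1 / q` are disjoint, then the
smallest slope is `1 / q`. -/
theorem le_one_of_sum_ediv_eq {q b c d : ℤ} (hdc : d ≤ c) (hcb : c ≤ b)
    (hsum : b + c + d = q + 1)
    (hc : ∀ k, 0 < k → k < q → ¬ q ∣ k * c) (hd : ∀ k, 0 < k → k < q → ¬ q ∣ k * d)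
    (h : ∀ k, 0 < k → k < q → k * b / q + k * c / q + k * d / q = k - 1) : d ≤ 1 := by
  by_contra! hd2
  have hq : 0 < q := by omega
  have mono : ∀ x, 0 ≤ x → ∀ k l, k ≤ l → k * x / q ≤ l * x / q := fun x hx k l hkl =>
    Int.ediv_le_ediv hq (mul_le_mul_of_nonneg_right hkl hx)
  have super : ∀ x k l, k * x / q + l * x / q ≤ (k + l) * x / q := fun x k l => by
    rw [add_mul]; exact ediv_add_ediv_le_add_ediv hq _ _
  have mono_b := mono b (by omega)
  have mono_c := mono c (by omega)
  have mono_d := mono d (by omega)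
  have one_c : 1 * c / q = 0 := Int.ediv_eq_zero_of_lt (by omega) (by omega)
  have one_d : 1 * d / q = 0 := Int.ediv_eq_zero_of_lt (by omega) (by omega)
  obtain ⟨m, hm⟩ := exists_forall_le_iff_le_mul_ediv (x := c) hq (by omega) 1
  obtain ⟨t, ht⟩ := exists_forall_le_iff_le_mul_ediv (x := d) hq (by omega) 1
  have hm2 : 2 ≤ m := by have := hm 1; omega
  have ht2 : 2 ≤ t := by have := ht 1; omega
  have hmt : m ≤ t := by
    have h1 := (ht t).1 le_rfl
    have h2 : t * d / q ≤ t * c / q :=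
      Int.ediv_le_ediv hq (mul_le_mul_of_nonneg_left hdc (by omega))
    exact (hm t).2 (by omega)
  have htq : t ≤ q - 1 := by
    have := mul_ediv_add_sub_mul_ediv hq (hd 1 one_pos (by omega))
    exact (ht _).2 (by omega)
  have h_t := h t (by omega) (by omega)
  have h_t' := h (t - 1) (by omega) (by omega)
  have hdt := (ht t).1 le_rfl
  have hdt' := ht (t - 1)
  have hdt0 := mono_d 1 (t - 1) (by omega)
  have hbt := mono_b (t - 1) t (by omega)
  have hct := mono_c (t - 1) t (by omega)
  have hmt1 : m + 1 ≤ t := by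
    have h1 := hm t
    have h2 := hm (t - 1)
    omega
  have h_2t : t ≤ q - t + 1 := by
    have := mul_ediv_add_sub_mul_ediv hq (hd (t - 1) (by omega) (by omega))
    rw [show q - (t - 1) = q - t + 1 by ring] at this
    exact (ht _).2 (by omega)
  have hj1 := (hm t).1 hmt
  have hjc : t * c / q + 1 ≤ (q - 1) * c / q := by
    have h1 := mul_ediv_add_sub_mul_ediv hq (hc 1 one_pos (by omega))
    have h2 := mul_ediv_add_sub_mul_ediv hq (hc t (by omega) (by omega))
    have h3 := (hm (q - t)).1 (by omega)
    omega
  obtain ⟨s, hs⟩ := exists_forall_le_iff_le_mul_ediv (x := c) hq (by omega) (t * c / q)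
  obtain ⟨s', hs'⟩ := exists_forall_le_iff_le_mul_ediv (x := c) hq (by omega) (t * c / q + 1)
  have hst : s ≤ t - 1 := (hs _).2 (by omega)
  have hst' : t < s' := by have := hs' t; omega
  have hsq : s' ≤ q - 1 := (hs' _).2 hjc
  have hs_s := (hs s).1 le_rfl
  have hs_s' := (hs' s').1 le_rfl
  have hms : m ≤ s := (hm s).2 (by omega)
  have hgap : s' ≤ s + m := by
    have h1 := super c s m
    have h2 := (hm m).1 le_rfl
    exact (hs' _).2 (by omega)
  have e1 := h s' (by omega) (by omega)
  have e2 := h (s - 1) (by omega) (by omega)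
  have e3 := hs (s - 1)
  have e4 := mono_d t s' hst'.le
  have e5 := ht (s - 1)
  have e6 := mono_d 1 (s - 1) (by omega)
  have hr := super b (s - 1) (s' - s + 1)
  rw [show s - 1 + (s' - s + 1) = s' by ring] at hr
  have hm3 : 3 ≤ m := by
    by_contra hm3
    have h2 := (hm 2).1 (by omega)
    rw [Int.le_ediv_iff_mul_le hq] at h2
    omega
  have small : ∀ k, 0 < k → k < m → k * b / q = k - 1 := fun k h0 h1 => by
    have h2 := h k h0 (by omega)
    have h3 := hm k
    have h4 := ht k
    have h5 := mono_c 1 k (by omega)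
    have h6 := mono_d 1 k (by omega)
    omega
  have f1 := small (m - 1) (by omega) (by omega)
  have f2 := small 2 (by omega) (by omega)
  have f3 := super b (m - 1) 2
  rw [show m - 1 + 2 = m + 1 by ring] at f3
  have f4 := mono_b (m - 1) m (by omega)
  rcases lt_trichotomy (s' - s + 1) m with hlt | heq | hgt
  · have := small _ (by omega) hlt
    omega
  · rw [heq] at hr
    omega
  · rw [show s' - s + 1 = m + 1 by omega] at hr
    omega

theorem eq_one_of_sum_ediv_eq {q b c d : ℤ} (hb0 : 0 < b) (hc0 : 0 < c) (hd0 : 0 < d)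
    (hsum : b + c + d = q + 1) (hb : ∀ k, 0 < k → k < q → ¬ q ∣ k * b)
    (hc : ∀ k, 0 < k → k < q → ¬ q ∣ k * c) (hd : ∀ k, 0 < k → k < q → ¬ q ∣ k * d)
    (h : ∀ k, 0 < k → k < q → k * b / q + k * c / q + k * d / q = k - 1) :
    b = 1 ∨ c = 1 ∨ d = 1 := by
  wlog hcb : c ≤ b generalizing b c
  · have := this hc0 hb0 (by omega) hc hb (fun k h0 h1 => by have := h k h0 h1; omega)
      (by omega)
    tauto
  wlog hdb : d ≤ b generalizing b d
  · have := this (b := d) (d := b) (hb0 := hd0) (hd0 := hb0) (hb := hd) (hd := hb)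
      (hsum := by omega) (h := fun k h0 h1 => by have := h k h0 h1; omega)
      (hcb := by omega) (by omega)
    tauto
  wlog hdc : d ≤ c generalizing c d
  · have := this (c := d) (d := c) (hc0 := hd0) (hd0 := hc0) (hc := hd) (hd := hc)
      (hsum := by omega) (h := fun k h0 h1 => by have := h k h0 h1; omega)
      (hcb := by omega) (hdb := by omega) (by omega)
    tauto
  have := le_one_of_sum_ediv_eq hdc hcb hsum hc hd h
  omega

theorem neg_emod_of_not_dvd {q a : ℤ} (hq : 0 < q) (h : ¬ q ∣ a) : -a % q = q - a % q := by
  have hm : 0 < a % q :=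
    lt_of_le_of_ne (Int.emod_nonneg _ hq.ne') fun h0 => h (Int.dvd_of_emod_eq_zero h0.symm)
  have e : -a = (q - a % q) + q * (-(a / q) - 1) := by
    linarith [Int.mul_ediv_add_emod a q]
  rw [e, Int.add_mul_emod_self_left]
  exact Int.emod_eq_of_lt (by have := Int.emod_lt_of_pos a hq; omega) (by omega)

theorem gcd_eq_one_of_forall_not_dvd_mul {q b : ℤ} (hq : 0 < q)
    (hb : ∀ k, 0 < k → k < q → ¬ q ∣ k * b) : Int.gcd b q = 1 := by
  by_contra hg
  have hg0 : 0 < Int.gcd b q := Int.gcd_pos_of_ne_zero_right _ hq.ne'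
  obtain ⟨e, he⟩ := Int.gcd_dvd_right b q
  obtain ⟨f, hf⟩ := Int.gcd_dvd_left b q
  have hg2 : (2 : ℤ) ≤ Int.gcd b q := by omega
  have he0 : 0 < e := by
    by_contra! h0
    nlinarith
  refine hb e he0 (by nlinarith) ⟨f, ?_⟩
  linear_combination e * hf - f * he

/-- The terminal lemma: if every nonzero multiple of `(-1, b, c)` in `(ℤ / q)³` has residues of
sum greater than `q`, then two of `-1, b, c, 1 - b - c` are opposite modulo `q`. -/
theorem dvd_of_residue_sum {q b c : ℤ} (hq : 0 < q)
    (H : ∀ k : ℤ, -k % q + k * b % q + k * c % q ≤ q → q ∣ k) :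
    Int.gcd b q = 1 ∧ Int.gcd c q = 1 ∧ (q ∣ b - 1 ∨ q ∣ c - 1 ∨ q ∣ b + c) := by
  have hndvd : ∀ k, 0 < k → k < q → ¬ q ∣ k := fun k h0 h1 h =>
    absurd (Int.le_of_dvd h0 h) (by omega)
  have hneg : ∀ k, 0 < k → k < q → -k % q = q - k := fun k h0 h1 => by
    rw [neg_emod_of_not_dvd hq (hndvd k h0 h1), Int.emod_eq_of_lt h0.le h1]
  have hlow : ∀ k, 0 < k → k < q → k < k * b % q + k * c % q := fun k h0 h1 => by
    by_contra! hle
    exact hndvd k h0 h1 (H k (by rw [hneg k h0 h1]; omega))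
  have hupp : ∀ k, 0 < k → k < q → q < k + -(k * b) % q + -(k * c) % q := fun k h0 h1 => by
    by_contra! hle
    refine hndvd k h0 h1 (Int.dvd_neg.1 (H (-k) ?_))
    rwa [neg_neg, neg_mul, neg_mul, Int.emod_eq_of_lt h0.le h1]
  have hlt := fun a => Int.emod_lt_of_pos a hq
  have hnn := fun a => Int.emod_nonneg a hq.ne'
  have hb : ∀ k, 0 < k → k < q → ¬ q ∣ k * b := fun k h0 h1 hk => by
    have e1 := hlow k h0 h1
    have e2 := hupp k h0 h1
    rw [Int.emod_eq_zero_of_dvd hk] at e1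
    rw [Int.emod_eq_zero_of_dvd (Int.dvd_neg.2 hk), neg_emod_of_not_dvd hq
      (fun h => by rw [Int.emod_eq_zero_of_dvd h] at e1; omega)] at e2
    omega
  have hc : ∀ k, 0 < k → k < q → ¬ q ∣ k * c := fun k h0 h1 hk => by
    have e1 := hlow k h0 h1
    have e2 := hupp k h0 h1
    rw [Int.emod_eq_zero_of_dvd hk] at e1
    rw [Int.emod_eq_zero_of_dvd (Int.dvd_neg.2 hk), neg_emod_of_not_dvd hq
      (fun h => by rw [Int.emod_eq_zero_of_dvd h] at e1; omega)] at e2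
    omega
  refine ⟨gcd_eq_one_of_forall_not_dvd_mul hq hb, gcd_eq_one_of_forall_not_dvd_mul hq hc, ?_⟩
  rcases (show q = 1 ∨ 1 < q by omega) with rfl | hq1
  · exact Or.inl (one_dvd _)
  have hmod : ∀ k, 0 < k → k < q →
      k * (1 - b - c) % q = q + k - k * b % q - k * c % q := fun k h0 h1 => by
    have e1 := hlow k h0 h1
    have e2 := hupp k h0 h1
    rw [neg_emod_of_not_dvd hq (hb k h0 h1), neg_emod_of_not_dvd hq (hc k h0 h1)] at e2
    have e : k * (1 - b - c) =
        (q + k - k * b % q - k * c % q) + q * (-1 - k * b / q - k * c / q) := by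
      linarith [Int.mul_ediv_add_emod (k * b) q, Int.mul_ediv_add_emod (k * c) q]
    rw [e, Int.add_mul_emod_self_left]
    exact Int.emod_eq_of_lt (by omega) (by omega)
  have hd : ∀ k, 0 < k → k < q → ¬ q ∣ k * (1 - b - c) := fun k h0 h1 hk => by
    have e1 := hmod k h0 h1
    have e2 := hupp k h0 h1
    rw [neg_emod_of_not_dvd hq (hb k h0 h1), neg_emod_of_not_dvd hq (hc k h0 h1)] at e2
    rw [Int.emod_eq_zero_of_dvd hk] at e1
    omega
  have red : ∀ k x, k * (x % q) % q = k * x % q := fun k x => by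
    rw [Int.mul_emod, Int.emod_emod_of_dvd _ dvd_rfl, ← Int.mul_emod]
  have red_dvd : ∀ k x, q ∣ k * (x % q) → q ∣ k * x := fun k x h => by
    rw [Int.dvd_iff_emod_eq_zero, red] at h
    exact Int.dvd_of_emod_eq_zero h
  have pos : ∀ x, (∀ k, 0 < k → k < q → ¬ q ∣ k * x) → 0 < x % q := fun x hx =>
    lt_of_le_of_ne (hnn x) fun h0 =>
      hx 1 one_pos hq1 (by rw [one_mul]; exact Int.dvd_of_emod_eq_zero h0.symm)
  have hsum : b % q + c % q + (1 - b - c) % q = q + 1 := by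
    have := hmod 1 one_pos hq1
    simp only [one_mul] at this
    omega
  have := eq_one_of_sum_ediv_eq (pos b hb) (pos c hc) (pos _ hd) hsum
    (fun k h0 h1 h => hb k h0 h1 (red_dvd _ _ h)) (fun k h0 h1 h => hc k h0 h1 (red_dvd _ _ h))
    (fun k h0 h1 h => hd k h0 h1 (red_dvd _ _ h)) (fun k h0 h1 => by
      have e1 := hmod k h0 h1
      have e2 := Int.mul_ediv_add_emod (k * (b % q)) q
      have e3 := Int.mul_ediv_add_emod (k * (c % q)) q
      have e4 := Int.mul_ediv_add_emod (k * ((1 - b - c) % q)) q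
      rw [red] at e2 e3 e4
      refine mul_left_cancel₀ hq.ne' ?_
      linear_combination e2 + e3 + e4 - e1 + k * hsum)
  have one : ∀ x, x % q = 1 → q ∣ x - 1 := fun x hx => by
    have := Int.dvd_self_sub_emod (x := x) (m := q)
    rwa [hx] at this
  rcases this with h | h | h
  · exact Or.inl (one _ h)
  · exact Or.inr (Or.inl (one _ h))
  · refine Or.inr (Or.inr ?_)
    have := one _ h
    rw [show 1 - b - c - 1 = -(b + c) by ring] at this
    exact Int.dvd_neg.1 this

open MeasureTheory in
/-- The volume of the corner simplex `{x | 0 ≤ x, ∑ x ≤ t}` in `ℝⁿ`. -/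
theorem volume_cornerSimplex (n : ℕ) {t : ℝ} (ht : 0 ≤ t) :
    volume {x : Fin n → ℝ | (∀ i, 0 ≤ x i) ∧ ∑ i, x i ≤ t} =
      ENNReal.ofReal (t ^ n / n.factorial) := by
  induction n generalizing t with
  | zero =>
    have : {x : Fin 0 → ℝ | (∀ i, 0 ≤ x i) ∧ ∑ i, x i ≤ t} = Set.univ := by
      ext x; simp [ht]
    rw [this]
    simp [volume_pi]
  | succ n ih =>
    have hmeas : MeasurableSet
        {p : ℝ × (Fin n → ℝ) | (0 ≤ p.1 ∧ ∀ i, 0 ≤ p.2 i) ∧ p.1 + ∑ i, p.2 i ≤ t} := by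
      apply IsClosed.measurableSet
      simp only [Set.ofPred_and, Set.ofPred_forall]
      refine ((isClosed_le (by fun_prop) (by fun_prop)).inter
        (isClosed_iInter fun i => isClosed_le (by fun_prop) (by fun_prop))).inter
        (isClosed_le (by fun_prop) (by fun_prop))
    have hpre : {x : Fin (n + 1) → ℝ | (∀ i, 0 ≤ x i) ∧ ∑ i, x i ≤ t} =
        MeasurableEquiv.piFinSuccAbove (fun _ => ℝ) 0 ⁻¹'
          {p : ℝ × (Fin n → ℝ) | (0 ≤ p.1 ∧ ∀ i, 0 ≤ p.2 i) ∧ p.1 + ∑ i, p.2 i ≤ t} := by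
      ext x
      simp [Fin.forall_fin_succ, Fin.sum_univ_succ, MeasurableEquiv.piFinSuccAbove,
        Fin.insertNthEquiv, Fin.tail]
    rw [hpre, (volume_preserving_piFinSuccAbove (fun _ => ℝ) 0).measure_preimage
      hmeas.nullMeasurableSet, Measure.volume_eq_prod, Measure.prod_apply hmeas]
    have hslice : ∀ s : ℝ, volume (Prod.mk s ⁻¹'
          {p : ℝ × (Fin n → ℝ) | (0 ≤ p.1 ∧ ∀ i, 0 ≤ p.2 i) ∧ p.1 + ∑ i, p.2 i ≤ t}) =
        (Set.Icc 0 t).indicator (fun s => ENNReal.ofReal ((t - s) ^ n / n.factorial)) s := by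
      intro s
      by_cases hs : s ∈ Set.Icc 0 t
      · rw [Set.indicator_of_mem hs, ← ih (sub_nonneg.2 hs.2)]
        congr 1
        ext x
        simp [hs.1, le_sub_iff_add_le']
      · rw [Set.indicator_of_notMem hs]
        convert measure_empty (μ := (volume : Measure (Fin n → ℝ)))
        ext x
        simp only [Set.mem_preimage, Set.mem_ofPred_eq, Set.mem_empty_iff_false, iff_false]
        rintro ⟨⟨h0, h1⟩, h2⟩
        exact hs ⟨h0, by linarith [Finset.sum_nonneg fun i (_ : i ∈ Finset.univ) => h1 i]⟩
    simp_rw [hslice]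
    rw [lintegral_indicator measurableSet_Icc, ← ofReal_integral_eq_lintegral_ofReal]
    · congr 1
      rw [integral_Icc_eq_integral_Ioc, ← intervalIntegral.integral_of_le ht,
        intervalIntegral.integral_div, intervalIntegral.integral_comp_sub_left (fun s => s ^ n),
        integral_pow, Nat.factorial_succ]
      push_cast
      field_simp
      simp
    · exact (by fun_prop : Continuous fun s : ℝ => (t - s) ^ n / n.factorial).integrableOn_Icc
    · filter_upwards [ae_restrict_mem measurableSet_Icc] with s hs
      have := sub_nonneg.2 hs.2
      positivity

/-- The convex hull of the origin and the standard basis vectors is the corner simplex. -/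
theorem convexHull_insert_zero_single (n : ℕ) :
    convexHull ℝ (insert 0 (Set.range fun i : Fin n => (Pi.single i 1 : Fin n → ℝ))) =
      {x | (∀ i, 0 ≤ x i) ∧ ∑ i, x i ≤ 1} := by
  apply subset_antisymm
  · refine convexHull_min ?_ ?_
    · rintro x (rfl | ⟨i, rfl⟩)
      · simp
      · refine ⟨fun j => ?_, by simp⟩
        by_cases h : j = i <;> simp [h]
    · rintro x ⟨hx, hx1⟩ y ⟨hy, hy1⟩ a b ha hb hab
      refine ⟨fun i => add_nonneg (mul_nonneg ha (hx i)) (mul_nonneg hb (hy i)), ?_⟩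
      simp only [Pi.add_apply, Pi.smul_apply, smul_eq_mul, Finset.sum_add_distrib,
        ← Finset.mul_sum]
      nlinarith
  · rintro x ⟨hx, hx1⟩
    have := (convex_convexHull ℝ
      (insert 0 (Set.range fun i : Fin n => (Pi.single i 1 : Fin n → ℝ)))).sum_mem
      (t := Finset.univ) (w := Fin.cons (1 - ∑ i, x i) x)
      (z := Fin.cons 0 fun i => Pi.single i 1)
      (fun i _ => by
        refine Fin.cases ?_ (fun i => ?_) i
        · simpa using hx1
        · simpa using hx i)
      (by simp [Fin.sum_univ_succ])
      (fun i _ => subset_convexHull _ _ (by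
        refine Fin.cases ?_ (fun i => ?_) i
        · simp
        · exact Or.inr ⟨i, rfl⟩))
    convert this
    ext j
    simp [Fin.sum_univ_succ, Finset.sum_apply, Pi.single_apply]

open MeasureTheory in
theorem volume_convexHull_range_fin_four (w : Fin 4 → Fin 3 → ℝ) :
    volume (convexHull ℝ (Set.range w)) =
      ENNReal.ofReal (|(Matrix.of fun a i : Fin 3 => w i.succ a - w 0 a).det| / 6) := by
  set M := Matrix.of fun a i : Fin 3 => w i.succ a - w 0 a with hM
  have hw : Set.range w = (w 0 + ·) '' (Matrix.toLin' M ''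
      insert 0 (Set.range fun i : Fin 3 => (Pi.single i 1 : Fin 3 → ℝ))) := by
    have h1 : ∀ i : Fin 3, w 0 + Matrix.toLin' M (Pi.single i 1) = w i.succ := fun i => by
      ext a
      simp [hM]
    rw [Set.image_insert_eq, Set.image_insert_eq, ← Set.range_comp, ← Set.range_comp,
      map_zero, add_zero]
    simp only [Function.comp_def, h1]
    rw [← Fin.range_cons]
    exact congrArg _ (Fin.cons_self_tail w).symm
  have h2 : convexHull ℝ (Set.range w) = (w 0 + ·) '' (Matrix.toLin' M ''
      {x | (∀ i, 0 ≤ x i) ∧ ∑ i, x i ≤ 1}) := by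
    rw [hw, ← convexHull_insert_zero_single, LinearMap.image_convexHull]
    exact ((AffineEquiv.constVAdd ℝ _ (w 0)).toAffineMap.image_convexHull _).symm
  rw [h2, Set.image_add_left, measure_preimage_add, Measure.addHaar_image_linearMap,
    volume_cornerSimplex 3 zero_le_one, LinearMap.det_toLin',
    ← ENNReal.ofReal_mul (abs_nonneg _)]
  congr 1
  norm_num [Nat.factorial]
  ring

/-- A tetrahedron `w` whose edge `w 3 - w 2` is `p • (w 1 - w 0)` modulo `q` is unimodularly
equivalent to `T(p,q)`. -/
theorem exists_isUnimodular_image_Tpq {p q : ℤ} (hq : q ≠ 0) (w : Fin 4 → Fin 3 → ℤ)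
    (y : Fin 3 → ℤ) (hy : ∀ a, w 3 a - w 2 a = p * (w 1 a - w 0 a) + q * y a)
    (hdet : |(Matrix.of fun a i : Fin 3 => w i.succ a - w 0 a).det| = |q|) :
    ∃ f, IsUnimodular f ∧
      f '' Tpq p q = convexHull ℝ (Set.range fun t => fun i => ((w t i : ℤ) : ℝ)) := by
  set A : Matrix (Fin 3) (Fin 3) ℤ :=
    Matrix.of fun a => ![w 1 a - w 0 a, y a, w 2 a - w 0 a] with hA
  have hAdet : (Matrix.of fun a i : Fin 3 => w i.succ a - w 0 a).det = -(q * A.det) := by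
    have e0 := hy 0
    have e1 := hy 1
    have e2 := hy 2
    rw [Matrix.det_fin_three, Matrix.det_fin_three]
    simp only [hA, Matrix.of_apply, Fin.succ_zero_eq_one, Fin.succ_one_eq_two,
      show Fin.succ (2 : Fin 3) = 3 from rfl, Matrix.cons_val]
    generalize w 0 = w0 at *
    generalize w 1 = w1 at *
    generalize w 2 = w2 at *
    generalize w 3 = w3 at *
    linear_combination
      ((w1 1 - w0 1) * (w2 2 - w0 2) - (w2 1 - w0 1) * (w1 2 - w0 2)) * e0 +
      ((w1 2 - w0 2) * (w2 0 - w0 0) - (w2 2 - w0 2) * (w1 0 - w0 0)) * e1 +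
      ((w1 0 - w0 0) * (w2 1 - w0 1) - (w2 0 - w0 0) * (w1 1 - w0 1)) * e2
  have hunit : IsUnit A.det := by
    rw [hAdet, abs_neg, abs_mul] at hdet
    rw [Int.isUnit_iff_abs_eq]
    exact mul_left_cancel₀ (abs_ne_zero.2 hq) (by rw [hdet, mul_one])
  refine ⟨fun x => (A.map (Int.cast : ℤ → ℝ)).mulVec x + fun i => (w 0 i : ℝ),
    ⟨A, hunit, w 0, fun _ => rfl⟩, ?_⟩
  let F : (Fin 3 → ℝ) →ᵃ[ℝ] (Fin 3 → ℝ) :=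
    (Matrix.toLin' (A.map (Int.cast : ℤ → ℝ))).toAffineMap +
      AffineMap.const ℝ _ fun i => (w 0 i : ℝ)
  change F '' _ = _
  rw [Tpq, AffineMap.image_convexHull]
  have hF : ∀ x i, F x i = (w 1 i - w 0 i) * x 0 + y i * x 1 + (w 2 i - w 0 i) * x 2 + w 0 i := by
    intro x i
    simp [F, hA, Matrix.mulVec, dotProduct, Fin.sum_univ_three]
  have h0 : F ![0, 0, 0] = fun i => (w 0 i : ℝ) := by
    ext i; simp [hF]
  have h1 : F ![1, 0, 0] = fun i => (w 1 i : ℝ) := by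
    ext i; simp [hF]
  have h2 : F ![0, 0, 1] = fun i => (w 2 i : ℝ) := by
    ext i; simp [hF]
  have h3 : F ![(p : ℝ), (q : ℝ), 1] = fun i => (w 3 i : ℝ) := by
    ext i
    have := congrArg (Int.cast : ℤ → ℝ) (hy i)
    push_cast at this
    simp only [hF, Matrix.cons_val]
    linear_combination -this
  congr 1
  rw [Set.image_insert_eq, Set.image_insert_eq, Set.image_insert_eq, Set.image_singleton,
    h0, h1, h2, h3]
  ext x
  simp [Fin.exists_fin_succ, eq_comm]

/-- In an empty tetrahedron with edge matrix `M` and `N * M = q`, a lattice point whose first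
three scaled barycentric coordinates `N *ᵥ y` have residues of sum at most `q` lies in the lattice
spanned by the edges. -/
theorem dvd_mulVec_of_residue_sum_le {q : ℤ} (hq : 0 < q) {v : Fin 4 → Fin 3 → ℤ}
    (hv : ∀ x : Fin 3 → ℤ, (fun i => (x i : ℝ)) ∈
      convexHull ℝ (Set.range fun t => fun i => ((v t i : ℤ) : ℝ)) → ∃ t, x = v t)
    {M N : Matrix (Fin 3) (Fin 3) ℤ} (hM : M = Matrix.of fun a i => v i.succ a - v 0 a)
    (hMN : M * N = q • 1) (hNM : N * M = q • 1) (y : Fin 3 → ℤ)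
    (hy : ∑ i, (N.mulVec y) i % q ≤ q) (i : Fin 3) : q ∣ (N.mulVec y) i := by
  set r : Fin 3 → ℤ := fun i => (N.mulVec y) i % q with hr
  set s : Fin 3 → ℤ := fun i => (N.mulVec y) i / q with hs
  have hNy : N.mulVec y = q • s + r := by
    ext i
    simp [hr, hs, Int.mul_ediv_add_emod]
  set z := y - M.mulVec s with hz
  have hqz : q • z = M.mulVec r := by
    have : M.mulVec (N.mulVec y) = q • y := by
      rw [Matrix.mulVec_mulVec, hMN, Matrix.smul_mulVec, Matrix.one_mulVec]
    rw [hNy, Matrix.mulVec_add, Matrix.mulVec_smul] at this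
    rw [hz, smul_sub, ← this]
    abel
  have hNz : N.mulVec z = r := by
    have : q • N.mulVec z = q • r := by
      rw [← Matrix.mulVec_smul, hqz, Matrix.mulVec_mulVec, hNM, Matrix.smul_mulVec,
        Matrix.one_mulVec]
    exact smul_right_injective _ hq.ne' this
  have hqR : (0 : ℝ) < q := by exact_mod_cast hq
  have hmem : (fun i => ((v 0 + z) i : ℝ)) ∈
      convexHull ℝ (Set.range fun t => fun i => ((v t i : ℤ) : ℝ)) := by
    have := (convex_convexHull ℝ (Set.range fun t => fun i => ((v t i : ℤ) : ℝ))).sum_mem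
      (t := Finset.univ) (w := Fin.cons (1 - (∑ i, r i : ℤ) / (q : ℝ)) fun i => r i / (q : ℝ))
      (z := fun t => fun i => ((v t i : ℤ) : ℝ))
      (fun i _ => by
        refine Fin.cases ?_ (fun i => ?_) i
        · rw [Fin.cons_zero, sub_nonneg, div_le_one hqR]
          exact_mod_cast hy
        · rw [Fin.cons_succ]
          exact div_nonneg (by exact_mod_cast Int.emod_nonneg _ hq.ne') hqR.le)
      (by simp [Fin.sum_univ_succ]; ring)
      (fun i _ => subset_convexHull _ _ ⟨i, rfl⟩)
    convert this
    rename_i a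
    have e := congrArg (Int.cast : ℤ → ℝ) (congrFun hqz a)
    simp only [hM, Matrix.mulVec, dotProduct, Fin.sum_univ_three, Pi.smul_apply, smul_eq_mul,
      Matrix.of_apply] at e
    push_cast at e
    simp [Fin.sum_univ_succ] at e ⊢
    field_simp
    linear_combination e
  obtain ⟨t, ht⟩ := hv _ hmem
  have hri : r i = 0 := by
    rw [← hNz]
    revert ht
    refine Fin.cases (fun ht => ?_) (fun j ht => ?_) t
    · rw [left_eq_add.1 ht.symm, Matrix.mulVec_zero, Pi.zero_apply]
    · have hzj : z = M.mulVec (Pi.single j 1) := by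
        ext a
        simp [hM, ← ht]
      have : r j = q := by
        rw [← hNz, hzj, Matrix.mulVec_mulVec, hNM, Matrix.smul_mulVec, Matrix.one_mulVec]
        simp
      exact absurd this (Int.emod_lt_of_pos _ hq).ne
  exact Int.dvd_of_emod_eq_zero hri

/-- Under the residue condition satisfied by empty tetrahedra, the facet opposite to the first
edge is unimodular: the first scaled barycentric coordinate takes the value `-1`. -/
theorem exists_mulVec_zero_eq_neg_one {q ε : ℤ} (hq : 0 < q) (hε : ε * ε = 1)
    {M N : Matrix (Fin 3) (Fin 3) ℤ} (hN : N = ε • M.adjugate) (hNM : N * M = q • 1)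
    (H : ∀ y : Fin 3 → ℤ, ∑ i, (N.mulVec y) i % q ≤ q → ∀ i, q ∣ (N.mulVec y) i) :
    ∃ x : Fin 3 → ℤ, (N.mulVec x) 0 = -1 := by
  have hker : ∀ y : Fin 3 → ℤ, (N.mulVec y) 0 = 0 → ∀ i, q ∣ (N.mulVec y) i := by
    intro y hy
    by_cases h : ∑ i, (N.mulVec y) i % q ≤ q
    · exact H y h
    · have hlt := fun i => Int.emod_lt_of_pos ((N.mulVec y) i) hq
      have hlt1 := hlt 1
      have hlt2 := hlt 2
      simp only [Fin.sum_univ_three, hy, Int.zero_emod] at h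
      have := H (-y) (by
        simp only [Matrix.mulVec_neg, Pi.neg_apply, Fin.sum_univ_three, hy, neg_zero,
          Int.zero_emod]
        rw [neg_emod_of_not_dvd hq (fun h1 => by rw [Int.emod_eq_zero_of_dvd h1] at h; omega),
          neg_emod_of_not_dvd hq (fun h1 => by rw [Int.emod_eq_zero_of_dvd h1] at h; omega)]
        omega)
      intro i
      simpa [Matrix.mulVec_neg] using this i
  obtain ⟨g, hg⟩ := (IsPrincipalIdealRing.principal
    (LinearMap.range (LinearMap.proj 0 ∘ₗ N.mulVecLin : (Fin 3 → ℤ) →ₗ[ℤ] ℤ))).principal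
  have hgmem : g ∈ LinearMap.range (LinearMap.proj 0 ∘ₗ N.mulVecLin : (Fin 3 → ℤ) →ₗ[ℤ] ℤ) := by
    rw [hg]; exact Submodule.mem_span_singleton_self g
  obtain ⟨x, hx⟩ := hgmem
  have hx : (N.mulVec x) 0 = g := hx
  have hdvd : ∀ a, g ∣ N 0 a := fun a => by
    have : N 0 a ∈ LinearMap.range
        (LinearMap.proj 0 ∘ₗ N.mulVecLin : (Fin 3 → ℤ) →ₗ[ℤ] ℤ) :=
      ⟨Pi.single a 1, by simp⟩
    rw [hg, Submodule.mem_span_singleton] at this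
    obtain ⟨c, hc⟩ := this
    exact ⟨c, by rw [← hc, smul_eq_mul, mul_comm]⟩
  have hg0 : g ≠ 0 := by
    rintro rfl
    have h1 := congrFun (congrFun hNM 0) 0
    simp only [zero_dvd_iff] at hdvd
    rw [Matrix.mul_apply] at h1
    simp [hdvd] at h1
    exact hq.ne h1
  have hmulVec : ∀ (y u : Fin 3 → ℤ), g • y = M.mulVec u → g • N.mulVec y = q • u := by
    intro y u h
    rw [← Matrix.mulVec_smul, h, Matrix.mulVec_mulVec, hNM, Matrix.smul_mulVec, Matrix.one_mulVec]
  have hker' : ∀ (y u : Fin 3 → ℤ), g • y = M.mulVec u → u 0 = 0 → ∀ i, g ∣ u i := by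
    intro y u h hu i
    have h1 := fun i => congrFun (hmulVec y u h) i
    simp only [Pi.smul_apply, smul_eq_mul] at h1
    obtain ⟨c, hc⟩ := hker y (by
      have := h1 0
      rw [hu, mul_zero] at this
      exact (mul_eq_zero.1 this).resolve_left hg0) i
    refine ⟨c, mul_left_cancel₀ hq.ne' ?_⟩
    rw [← h1 i, hc]
    ring
  have hcross : ∀ a b, g ∣ M b 1 * M a 2 - M b 2 * M a 1 := by
    have hadj : ∀ a, g ∣ M.adjugate 0 a := fun a => by
      have : M.adjugate 0 a = ε * N 0 a := by
        rw [hN, Matrix.smul_apply, smul_eq_mul, ← mul_assoc, hε, one_mul]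
      rw [this]
      exact (hdvd a).mul_left ε
    obtain ⟨c0, h0⟩ := hadj 0
    obtain ⟨c1, h1⟩ := hadj 1
    obtain ⟨c2, h2⟩ := hadj 2
    simp only [Matrix.adjugate_fin_three, Matrix.of_apply, Matrix.cons_val] at h0 h1 h2
    intro a b
    fin_cases a <;> fin_cases b <;> simp only [Fin.zero_eta, Fin.mk_one, Fin.reduceFinMk]
    all_goals first
      | exact ⟨0, by ring1⟩
      | exact ⟨c0, by linear_combination h0⟩
      | exact ⟨c1, by linear_combination h1⟩
      | exact ⟨c2, by linear_combination h2⟩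
      | exact ⟨-c0, by linear_combination -h0⟩
      | exact ⟨-c1, by linear_combination -h1⟩
      | exact ⟨-c2, by linear_combination -h2⟩
  have hcol : ∀ a, g ∣ M a 1 := fun a => by
    choose y hy using hcross a
    have := hker' y ![0, M a 2, -M a 1] (by
      ext b
      simp [Matrix.mulVec, dotProduct, Fin.sum_univ_three, ← hy]
      ring) rfl 2
    simpa using this
  have hg1 : g ∣ 1 := by
    choose y hy using hcol
    have := hker' y (Pi.single 1 1) (by ext b; simp [← hy]) (by simp) 1
    simpa using this
  obtain ⟨c, hc⟩ := hg1
  refine ⟨(-c) • x, ?_⟩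
  rw [Matrix.mulVec_smul, Pi.smul_apply, hx, smul_eq_mul, hc]
  ring

/-- Renumbering the vertices of a tetrahedron preserves its absolute determinant. -/
theorem abs_det_edges_perm (v : Fin 4 → Fin 3 → ℤ) (e : Equiv.Perm (Fin 4)) :
    |(Matrix.of fun a i : Fin 3 => v (e i.succ) a - v (e 0) a).det| =
      |(Matrix.of fun a i : Fin 3 => v i.succ a - v 0 a).det| := by
  have hW : ∀ w : Fin 4 → Fin 3 → ℤ,
      (Matrix.of fun a i : Fin 3 => w i.succ a - w 0 a).det =
        (Matrix.of fun i => (Fin.cons 1 (w i) : Fin 4 → ℤ)).det := by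
    intro w
    have c2 : ∀ u : Fin 3 → ℤ, (Fin.cons 1 u : Fin 4 → ℤ) 2 = u 1 := fun _ => rfl
    have c3 : ∀ u : Fin 3 → ℤ, (Fin.cons 1 u : Fin 4 → ℤ) 3 = u 2 := fun _ => rfl
    rw [Matrix.det_fin_three, Matrix.det_succ_row_zero]
    simp [c2, c3, Fin.sum_univ_succ, Matrix.det_fin_three, Fin.succAbove]
    ring
  rw [hW v, hW fun t => v (e t)]
  have : (Matrix.of fun i => (Fin.cons 1 (v (e i)) : Fin 4 → ℤ)) =
      (Matrix.of fun i => (Fin.cons 1 (v i) : Fin 4 → ℤ)).submatrix e id := rfl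
  rw [this, Matrix.det_permute, abs_mul]
  rcases Int.units_eq_one_or (Equiv.Perm.sign e) with h | h <;> simp [h]

/-- If `x` has scaled barycentric coordinates `(-1, b, c)` and two of
`-1, b, c, 1 - b - c` are opposite modulo `q`, the tetrahedron is equivalent to some `T(p,q)`. -/
theorem exists_image_Tpq_of_dvd {q b c : ℤ} (hq : 0 < q) {v : Fin 4 → Fin 3 → ℤ}
    (hdet : |(Matrix.of fun a i : Fin 3 => v i.succ a - v 0 a).det| = q) (x : Fin 3 → ℤ)
    (hx : ∀ a, q * x a = -(v 1 a - v 0 a) + (v 2 a - v 0 a) * b + (v 3 a - v 0 a) * c)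
    (hb : Int.gcd b q = 1) (hc : Int.gcd c q = 1) (h : q ∣ b - 1 ∨ q ∣ c - 1 ∨ q ∣ b + c) :
    ∃ p : ℤ, Int.gcd p q = 1 ∧ ∃ f, IsUnimodular f ∧ f '' Tpq p q =
      convexHull ℝ (Set.range fun t => fun i => ((v t i : ℤ) : ℝ)) := by
  have key : ∀ (e : Equiv.Perm (Fin 4)) (p : ℤ) (y : Fin 3 → ℤ), Int.gcd p q = 1 →
      (∀ a, v (e 3) a - v (e 2) a = p * (v (e 1) a - v (e 0) a) + q * y a) →
      ∃ p : ℤ, Int.gcd p q = 1 ∧ ∃ f, IsUnimodular f ∧ f '' Tpq p q =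
        convexHull ℝ (Set.range fun t => fun i => ((v t i : ℤ) : ℝ)) := by
    intro e p y hp hy
    refine ⟨p, hp, ?_⟩
    rw [← e.surjective.range_comp fun t => fun i => ((v t i : ℤ) : ℝ)]
    refine exists_isUnimodular_image_Tpq hq.ne' (fun t => v (e t)) y hy ?_
    rw [abs_of_pos hq, ← hdet, abs_det_edges_perm v e]
  rcases h with ⟨k, hk⟩ | ⟨k, hk⟩ | ⟨k, hk⟩
  · refine key ⟨![0, 3, 1, 2], ![0, 2, 3, 1], by decide, by decide⟩ (-c)
      (fun a => x a - k * (v 2 a - v 0 a)) (by rwa [Int.neg_gcd]) (fun a => ?_)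
    change v 2 a - v 1 a = -c * (v 3 a - v 0 a) + q * (x a - k * (v 2 a - v 0 a))
    linear_combination -(v 2 a - v 0 a) * hk - hx a
  · refine key ⟨![0, 2, 1, 3], ![0, 2, 1, 3], by decide, by decide⟩ (-b)
      (fun a => x a - k * (v 3 a - v 0 a)) (by rwa [Int.neg_gcd]) (fun a => ?_)
    change v 3 a - v 1 a = -b * (v 2 a - v 0 a) + q * (x a - k * (v 3 a - v 0 a))
    linear_combination -(v 3 a - v 0 a) * hk - hx a
  · refine key ⟨![3, 2, 0, 1], ![2, 3, 1, 0], by decide, by decide⟩ b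
      (fun a => -(x a - k * (v 3 a - v 0 a))) hb (fun a => ?_)
    change v 1 a - v 0 a = b * (v 2 a - v 3 a) + q * -(x a - k * (v 3 a - v 0 a))
    linear_combination hx a + (v 3 a - v 0 a) * hk

/-- White's theorem (existence): every empty tetrahedron in `ℝ³` of determinant `q`
(i.e. of volume `q/6`) is the unimodular image of `T(p,q)` for some `p` coprime to `q`. -/
theorem white_existence (q : ℤ) (hq : 1 ≤ q) (P : Set (Fin 3 → ℝ))
    (hP : IsEmptyTetrahedron P)
    (hvol : MeasureTheory.volume P = ENNReal.ofReal ((q : ℝ) / 6)) :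
    ∃ p : ℤ, Int.gcd p q = 1 ∧ ∃ f, IsUnimodular f ∧ f '' Tpq p q = P := by
  obtain ⟨v, -, rfl, hv⟩ := hP
  have hq0 : 0 < q := hq
  set M : Matrix (Fin 3) (Fin 3) ℤ := Matrix.of fun a i => v i.succ a - v 0 a with hM
  have hdet : |M.det| = q := by
    rw [volume_convexHull_range_fin_four, ENNReal.ofReal_eq_ofReal_iff (by positivity)
      (by positivity), div_left_inj' (by norm_num)] at hvol
    have : (Matrix.of fun a i : Fin 3 => (v i.succ a : ℝ) - (v 0 a : ℝ)) =
        M.map (Int.castRingHom ℝ) := by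
      ext; simp [hM]
    rw [this, ← RingHom.mapMatrix_apply, ← RingHom.map_det, eq_intCast] at hvol
    exact_mod_cast hvol
  obtain ⟨ε, hε, hεM⟩ : ∃ ε : ℤ, ε * ε = 1 ∧ ε * M.det = q := by
    rcases abs_choice M.det with h | h
    · exact ⟨1, by norm_num, by omega⟩
    · exact ⟨-1, by norm_num, by omega⟩
  set N := ε • M.adjugate with hN
  have hMN : M * N = q • 1 := by
    rw [hN, Matrix.mul_smul, Matrix.mul_adjugate, smul_smul, hεM]
  have hNM : N * M = q • 1 := by
    rw [hN, Matrix.smul_mul, Matrix.adjugate_mul, smul_smul, hεM]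
  have H := dvd_mulVec_of_residue_sum_le hq0 hv hM hMN hNM
  obtain ⟨x, hx⟩ := exists_mulVec_zero_eq_neg_one hq0 hε hN hNM H
  obtain ⟨hgb, hgc, hcases⟩ := dvd_of_residue_sum (b := N.mulVec x 1) (c := N.mulVec x 2) hq0
    (fun k hk => by
      have := H (k • x) (by
        simpa only [Matrix.mulVec_smul, Pi.smul_apply, smul_eq_mul, Fin.sum_univ_three, hx,
          mul_neg_one] using hk) 0
      rwa [Matrix.mulVec_smul, Pi.smul_apply, hx, smul_eq_mul, mul_neg_one, Int.dvd_neg] at this)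
  have hqx : ∀ a, q * x a = -(v 1 a - v 0 a) + (v 2 a - v 0 a) * N.mulVec x 1 +
      (v 3 a - v 0 a) * N.mulVec x 2 := fun a => by
    have : M.mulVec (N.mulVec x) = q • x := by
      rw [Matrix.mulVec_mulVec, hMN, Matrix.smul_mulVec, Matrix.one_mulVec]
    have := congrFun this a
    rw [Pi.smul_apply, smul_eq_mul] at this
    rw [← this, Matrix.mulVec, dotProduct, Fin.sum_univ_three, hx, hM]
    simp only [Matrix.of_apply, Fin.succ_zero_eq_one, Fin.succ_one_eq_two,
      show Fin.succ (2 : Fin 3) = 3 from rfl]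
    ring
  exact exists_image_Tpq_of_dvd hq0 hdet x hqx hgb hgc hcases
end

section
/- For integers q ≥ 1 and p, p' with gcd(p,q) = gcd(p',q) = 1, the empty tetrahedra T(p,q) and T(p',q) are unimodularly equivalent (i.e. there is a unimodular transformation mapping one onto the other) if and only if p' ≡ p, p' ≡ −p, p'·p ≡ 1, or p'·p ≡ −1 modulo q. -/
open Pointwise

/-- The vertices of `Tpq p q`, as integer vectors. -/
def Tpq.vertex (p q : ℤ) : Fin 4 → Fin 3 → ℤ :=
  ![![0, 0, 0], ![1, 0, 0], ![0, 0, 1], ![p, q, 1]]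

/-- The affine map `x ↦ A·x + b` of `ℝ^n` with integer coefficients. -/
noncomputable def intAffineMap {n : ℕ} (A : Matrix (Fin n) (Fin n) ℤ) (b : Fin n → ℤ) :
    (Fin n → ℝ) →ᵃ[ℝ] (Fin n → ℝ) :=
  (Matrix.mulVecLin (A.map (Int.cast : ℤ → ℝ))).toAffineMap +
    AffineMap.const ℝ _ (fun i => (b i : ℝ))

theorem intAffineMap_apply {n : ℕ} (A : Matrix (Fin n) (Fin n) ℤ) (b : Fin n → ℤ)
    (x : Fin n → ℝ) :
    intAffineMap A b x = (A.map (Int.cast : ℤ → ℝ)).mulVec x + fun i => (b i : ℝ) := by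
  simp [intAffineMap]

theorem intAffineMap_intCast {n : ℕ} (A : Matrix (Fin n) (Fin n) ℤ) (b v : Fin n → ℤ) :
    intAffineMap A b (fun k => (v k : ℝ)) = fun k => ((A.mulVec v + b) k : ℝ) := by
  ext k
  simp [intAffineMap_apply, Matrix.mulVec, dotProduct]

theorem isUnimodular_iff {n : ℕ} {f : (Fin n → ℝ) → (Fin n → ℝ)} :
    IsUnimodular f ↔ ∃ A : Matrix (Fin n) (Fin n) ℤ, IsUnit A.det ∧ ∃ b : Fin n → ℤ,
      f = intAffineMap A b := by
  simp only [IsUnimodular, funext_iff, intAffineMap_apply]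

theorem Tpq_eq_convexHull_range (p q : ℤ) :
    Tpq p q = convexHull ℝ (Set.range fun i k => (Tpq.vertex p q i k : ℝ)) := by
  have h : (fun (i : Fin 4) (k : Fin 3) => (Tpq.vertex p q i k : ℝ)) =
      ![![0, 0, 0], ![1, 0, 0], ![0, 0, 1], ![(p : ℝ), (q : ℝ), 1]] := by
    ext i k
    fin_cases i <;> fin_cases k <;> simp [Tpq.vertex]
  rw [h, Tpq]
  congr 1
  ext x
  simp only [Matrix.range_cons, Matrix.range_empty]
  simp
  tauto

/-- Nonnegativity of the barycentric coordinates (scaled by `q`) on `Tpq p q`. -/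
theorem Tpq_subset {p q : ℤ} (hq : 0 < q) :
    Tpq p q ⊆ {x | 0 ≤ x 1 ∧ 0 ≤ q * x 2 - x 1 ∧ 0 ≤ q * x 0 - p * x 1 ∧
      0 ≤ q - q * x 0 - q * x 2 + p * x 1} := by
  have hq' : (0 : ℝ) < q := by exact_mod_cast hq
  refine convexHull_min ?_ ?_
  · rintro x (rfl | rfl | rfl | rfl) <;>
      simp [hq'.le, mul_comm]
  · rintro x ⟨hx1, hx2, hx3, hx4⟩ y ⟨hy1, hy2, hy3, hy4⟩ a b ha hb hab
    obtain rfl : b = 1 - a := by linarith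
    simp only [Set.mem_ofPred_eq, Pi.add_apply, Pi.smul_apply, smul_eq_mul]
    refine ⟨?_, ?_, ?_, ?_⟩
    · nlinarith [mul_nonneg ha hx1, mul_nonneg hb hy1]
    · nlinarith [mul_nonneg ha hx2, mul_nonneg hb hy2]
    · nlinarith [mul_nonneg ha hx3, mul_nonneg hb hy3]
    · nlinarith [mul_nonneg ha hx4, mul_nonneg hb hy4]

theorem eq_zero_of_pos_combination_eq_zero {a b u v : ℝ} (ha : 0 < a) (hb : 0 < b)
    (hu : 0 ≤ u) (hv : 0 ≤ v) (h : a * u + b * v = 0) : u = 0 := by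
  have := mul_nonneg ha.le hu
  have := mul_nonneg hb.le hv
  have h0 : a * u = 0 := by linarith
  simpa [ha.ne'] using h0

theorem vertex_mem_extremePoints {p q : ℤ} (hq : 0 < q) (i : Fin 4) :
    (fun k => (Tpq.vertex p q i k : ℝ)) ∈ (Tpq p q).extremePoints ℝ := by
  have hq' : (0 : ℝ) < q := by exact_mod_cast hq
  refine mem_extremePoints_iff_left.2 ⟨?_, ?_⟩
  · rw [Tpq_eq_convexHull_range]
    exact subset_convexHull ℝ _ ⟨i, rfl⟩
  · rintro x hx y hy ⟨a, b, ha, hb, hab, h⟩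
    obtain ⟨hx1, hx2, hx3, hx4⟩ := Tpq_subset hq hx
    obtain ⟨hy1, hy2, hy3, hy4⟩ := Tpq_subset hq hy
    have h0 := congrFun h 0
    have h1 := congrFun h 1
    have h2 := congrFun h 2
    obtain rfl : b = 1 - a := by linarith
    have e1 := eq_zero_of_pos_combination_eq_zero ha hb hx1 hy1
    have e2 := eq_zero_of_pos_combination_eq_zero ha hb hx2 hy2
    have e3 := eq_zero_of_pos_combination_eq_zero ha hb hx3 hy3
    have e4 := eq_zero_of_pos_combination_eq_zero ha hb hx4 hy4
    have key : ∀ X Y Z : ℝ, q * x 0 = q * X → x 1 = Y → q * x 2 = q * Z → x = ![X, Y, Z] := by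
      intro X Y Z hX hY hZ
      ext k
      fin_cases k
      · exact mul_left_cancel₀ hq'.ne' hX
      · exact hY
      · exact mul_left_cancel₀ hq'.ne' hZ
    have hv : (fun k => (Tpq.vertex p q i k : ℝ)) =
        ![(Tpq.vertex p q i 0 : ℝ), Tpq.vertex p q i 1, Tpq.vertex p q i 2] := by
      ext k
      fin_cases k <;> rfl
    rw [hv]
    fin_cases i <;> simp [Tpq.vertex] at h0 h1 h2 ⊢ <;> apply key
    all_goals grind

theorem Tpq.vertex_injective {p q : ℤ} (hq : 0 < q) : Function.Injective (Tpq.vertex p q) := by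
  intro i j h
  have h0 := congrFun h 0
  have h1 := congrFun h 1
  have h2 := congrFun h 2
  fin_cases i <;> fin_cases j <;> simp [Tpq.vertex] at h0 h1 h2 ⊢ <;> omega

/-- An integral affine map carries `Tpq p q` onto `Tpq p' q` if and only if it permutes the
vertices. -/
theorem intAffineMap_image_Tpq_iff {p p' q : ℤ} (hq : 0 < q) (A : Matrix (Fin 3) (Fin 3) ℤ)
    (b : Fin 3 → ℤ) :
    intAffineMap A b '' Tpq p q = Tpq p' q ↔ ∃ σ : Equiv.Perm (Fin 4),
      ∀ i, A.mulVec (Tpq.vertex p q i) + b = Tpq.vertex p' q (σ i) := by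
  have himage : intAffineMap A b '' Tpq p q = convexHull ℝ
      (Set.range fun i k => ((A.mulVec (Tpq.vertex p q i) + b) k : ℝ)) := by
    rw [Tpq_eq_convexHull_range, AffineMap.image_convexHull, ← Set.range_comp]
    simp only [Function.comp_def, intAffineMap_intCast]
  rw [himage]
  constructor
  · intro h
    have hτ : ∀ j, ∃ i, A.mulVec (Tpq.vertex p q i) + b = Tpq.vertex p' q j := by
      intro j
      have hj := vertex_mem_extremePoints (p := p') hq j
      rw [← h] at hj
      obtain ⟨i, hi⟩ := extremePoints_convexHull_subset hj
      refine ⟨i, funext fun k => ?_⟩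
      exact Int.cast_injective (α := ℝ) (congrFun hi k)
    choose τ hτ using hτ
    have hinj : Function.Injective τ := fun i j hij =>
      Tpq.vertex_injective hq (by rw [← hτ i, ← hτ j, hij])
    refine ⟨(Equiv.ofBijective τ (Finite.injective_iff_bijective.1 hinj)).symm, fun i => ?_⟩
    rw [← hτ]
    congr
    exact ((Equiv.ofBijective τ _).apply_symm_apply i).symm
  · rintro ⟨σ, hσ⟩
    simp only [hσ]
    rw [Tpq_eq_convexHull_range]
    exact congrArg _ (σ.surjective.range_comp fun i k => (Tpq.vertex p' q i k : ℝ))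

theorem exists_isUnimodular_iff {p p' q : ℤ} (hq : 0 < q) :
    (∃ f, IsUnimodular f ∧ f '' Tpq p q = Tpq p' q) ↔
      ∃ A : Matrix (Fin 3) (Fin 3) ℤ, IsUnit A.det ∧ ∃ b : Fin 3 → ℤ, ∃ σ : Equiv.Perm (Fin 4),
        ∀ i, A.mulVec (Tpq.vertex p q i) + b = Tpq.vertex p' q (σ i) := by
  simp only [isUnimodular_iff, ← intAffineMap_image_Tpq_iff hq]
  constructor
  · rintro ⟨_, ⟨A, hA, b, rfl⟩, h⟩
    exact ⟨A, hA, b, h⟩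
  · rintro ⟨A, hA, b, h⟩
    exact ⟨_, ⟨A, hA, b, rfl⟩, h⟩

/-- The affine relation modulo `q` between the vertices of `Tpq p q` is preserved by
integral affine maps. -/
theorem dvd_of_mulVec_vertex {p p' q : ℤ} {A : Matrix (Fin 3) (Fin 3) ℤ} {b : Fin 3 → ℤ}
    {σ : Fin 4 → Fin 4}
    (h : ∀ i, A.mulVec (Tpq.vertex p q i) + b = Tpq.vertex p' q (σ i)) (k : Fin 3) :
    q ∣ p * (Tpq.vertex p' q (σ 1) k - Tpq.vertex p' q (σ 0) k) +
      Tpq.vertex p' q (σ 2) k - Tpq.vertex p' q (σ 3) k := by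
  refine ⟨-A k 1, ?_⟩
  simp only [← h]
  simp [Tpq.vertex, Matrix.mulVec, dotProduct, Fin.sum_univ_three]
  ring

theorem eq_of_vertex_relation {R : Type*} [CommRing R] {x y : R} {a b c d : Fin 4}
    (hab : a ≠ b) (hac : a ≠ c) (had : a ≠ d) (hbc : b ≠ c) (hbd : b ≠ d) (hcd : c ≠ d)
    (h₀ : x * (![0, 1, 0, y] b - ![0, 1, 0, y] a) + ![0, 1, 0, y] c - ![0, 1, 0, y] d = 0)
    (h₂ : x * (![0, 0, 1, 1] b - ![0, 0, 1, 1] a) + ![0, 0, 1, 1] c - ![0, 0, 1, 1] d = 0) :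
    y = x ∨ y = -x ∨ y * x = 1 ∨ y * x = -1 := by
  fin_cases a <;> fin_cases b <;> first | exact absurd rfl hab | skip
  all_goals fin_cases c <;> first | exact absurd rfl hac | exact absurd rfl hbc | skip
  all_goals
    fin_cases d <;>
      first | exact absurd rfl had | exact absurd rfl hbd | exact absurd rfl hcd | skip
  all_goals
    simp at h₀ h₂
    grind

theorem modEq_of_perm {p p' q : ℤ} (σ : Equiv.Perm (Fin 4))
    (h : ∀ k, q ∣ p * (Tpq.vertex p' q (σ 1) k - Tpq.vertex p' q (σ 0) k) +
      Tpq.vertex p' q (σ 2) k - Tpq.vertex p' q (σ 3) k) :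
    p' ≡ p [ZMOD q] ∨ p' ≡ -p [ZMOD q] ∨ p' * p ≡ 1 [ZMOD q] ∨ p' * p ≡ -1 [ZMOD q] := by
  let π := Ideal.Quotient.mk (Ideal.span {q})
  have hπ : ∀ m : ℤ, π m = 0 ↔ q ∣ m := fun m => by
    rw [Ideal.Quotient.eq_zero_iff_mem, Ideal.mem_span_singleton]
  have hmod : ∀ m n : ℤ, m ≡ n [ZMOD q] ↔ π m = π n := fun m n => by
    rw [Int.modEq_comm, Int.modEq_iff_dvd, ← hπ, map_sub, sub_eq_zero]
  have hX : ∀ i, π (Tpq.vertex p' q i 0) = ![0, 1, 0, π p'] i := fun i => by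
    fin_cases i <;> simp [Tpq.vertex]
  have hZ : ∀ i, π (Tpq.vertex p' q i 2) = ![0, 0, 1, 1] i := fun i => by
    fin_cases i <;> simp [Tpq.vertex]
  have h₀ := (hπ _).2 (h 0)
  have h₂ := (hπ _).2 (h 2)
  simp only [map_sub, map_add, map_mul, hX, hZ] at h₀ h₂
  simp only [hmod, map_neg, map_mul, map_one]
  have hne : ∀ {i j}, i ≠ j → σ i ≠ σ j := σ.injective.ne
  exact eq_of_vertex_relation (hne (by decide)) (hne (by decide)) (hne (by decide))
    (hne (by decide)) (hne (by decide)) (hne (by decide)) h₀ h₂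

/-- White's theorem (uniqueness): `T(p,q)` and `T(p',q)` are unimodularly equivalent iff
`p' ≡ ±p^{±1} (mod q)`. -/
theorem white_uniqueness (q p p' : ℤ) (hq : 1 ≤ q)
    (hp : Int.gcd p q = 1) (hp' : Int.gcd p' q = 1) :
    (∃ f, IsUnimodular f ∧ f '' Tpq p q = Tpq p' q) ↔
      (p' ≡ p [ZMOD q] ∨ p' ≡ -p [ZMOD q] ∨ p' * p ≡ 1 [ZMOD q] ∨ p' * p ≡ -1 [ZMOD q]) := by
  rw [exists_isUnimodular_iff (by omega)]
  constructor
  · rintro ⟨A, -, b, σ, h⟩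
    exact modEq_of_perm σ (dvd_of_mulVec_vertex h)
  · rintro (h | h | h | h) <;> obtain ⟨k, hk⟩ := h.symm.dvd
    · refine ⟨!![1, k, 0; 0, 1, 0; 0, 0, 1], ?_, ![0, 0, 0], Equiv.refl _, fun i => ?_⟩
      · simp [Matrix.det_fin_three]
      · ext j
        fin_cases i <;> fin_cases j <;>
          simp [Tpq.vertex] <;> linarith
    · refine ⟨!![-1, k, -1; 0, 1, 0; 0, 0, 1], ?_, ![1, 0, 0],
        ⟨![1, 0, 2, 3], ![1, 0, 2, 3], by decide, by decide⟩, fun i => ?_⟩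
      · simp [Matrix.det_fin_three]
      · ext j
        fin_cases i <;> fin_cases j <;>
          simp [Tpq.vertex] <;> linarith
    · refine ⟨!![p', -k, 0; q, -p, 0; 0, 0, -1], ?_, ![0, 0, 1],
        ⟨![2, 3, 0, 1], ![2, 3, 0, 1], by decide, by decide⟩, fun i => ?_⟩
      · rw [Matrix.det_fin_three, Int.isUnit_iff]
        simp
        left; linarith
      · ext j
        fin_cases i <;> fin_cases j <;>
          simp [Tpq.vertex] <;> linarith
    · refine ⟨!![p', -k, 1; q, -p, 0; 0, 0, -1], ?_, ![0, 0, 1],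
        ⟨![2, 3, 1, 0], ![3, 2, 0, 1], by decide, by decide⟩, fun i => ?_⟩
      · rw [Matrix.det_fin_three, Int.isUnit_iff]
        simp
        right; linarith
      · ext j
        fin_cases i <;> fin_cases j <;>
          simp [Tpq.vertex] <;> linarith
end

section
/- Let q ≥ 1 and p be integers with gcd(p,q) = 1 and let T = T(p,q). Set T⁻ = T ∩ (ℝ² × [0, ½]) and T⁺ = T ∩ (ℝ² × [½, 1]). Then each of T⁻ and T⁺ is the union of a finite family of half-unimodular 3-simplices, each having at least one vertex in ℤ³, such that any two simplices of the family intersect in a common (possibly empty) face of both. -/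
open Pointwise

/-- A half-unimodular 3-simplex in `ℝ³`: `2Δ` is the unimodular image of `conv(0,e₁,e₂,e₃)`. -/
def IsHalfUnimodular3Simplex (Δ : Set (Fin 3 → ℝ)) : Prop :=
  ∃ f, IsUnimodular f ∧ (2 : ℝ) • Δ = f '' baseSimplex 3 3

/-- `S` is the union of a finite family of half-unimodular 3-simplices, each with a vertex
in `ℤ³`, any two of which intersect in a common (possibly empty) face of both. -/
def HasGoodHalfUnimodularTriangulation (S : Set (Fin 3 → ℝ)) : Prop :=
  ∃ (r : ℕ) (V : Fin r → Fin 4 → (Fin 3 → ℝ)),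
    (∀ t, AffineIndependent ℝ (V t)) ∧
    (∀ t, IsHalfUnimodular3Simplex (convexHull ℝ (Set.range (V t)))) ∧
    (∀ t, ∃ j : Fin 4, ∀ i, ∃ m : ℤ, V t j i = (m : ℝ)) ∧
    S = (⋃ t, convexHull ℝ (Set.range (V t))) ∧
    ∀ t s : Fin r, ∃ W : Set (Fin 3 → ℝ), W ⊆ Set.range (V t) ∧ W ⊆ Set.range (V s) ∧
      convexHull ℝ (Set.range (V t)) ∩ convexHull ℝ (Set.range (V s)) = convexHull ℝ W

/-! ### Convex hulls meeting in a common face -/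

/-- The convex hulls of `A` and `B` meet exactly in the convex hull of `A ∩ B`. -/
def MeetsInFace (A B : Set (Fin 3 → ℝ)) : Prop :=
  convexHull ℝ A ∩ convexHull ℝ B ⊆ convexHull ℝ (A ∩ B)

/-- A real function on `ℝ³` that preserves affine combinations of two points. -/
def PreservesAffine (f : (Fin 3 → ℝ) → ℝ) : Prop :=
  ∀ v w s t, s + t = 1 → f (s • v + t • w) = s * f v + t * f w

theorem MeetsInFace.symm {A B : Set (Fin 3 → ℝ)} (h : MeetsInFace A B) : MeetsInFace B A := by
  intro x hx
  rw [Set.inter_comm]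
  exact h ⟨hx.2, hx.1⟩

theorem MeetsInFace.of_subset {A B : Set (Fin 3 → ℝ)} (h : B ⊆ A) : MeetsInFace A B := by
  intro x hx
  rw [Set.inter_eq_right.2 h]
  exact hx.2

theorem PreservesAffine.neg {f : (Fin 3 → ℝ) → ℝ} (hf : PreservesAffine f) :
    PreservesAffine fun v => -f v := by
  intro v w s t hst
  simp only [hf v w s t hst]
  ring

theorem PreservesAffine.mem_face {f : (Fin 3 → ℝ) → ℝ} (hf : PreservesAffine f)
    {A : Set (Fin 3 → ℝ)} (hA : ∀ v ∈ A, f v ≤ 0) {x : Fin 3 → ℝ} (hx : x ∈ convexHull ℝ A) :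
    f x ≤ 0 ∧ (f x = 0 → x ∈ convexHull ℝ {v ∈ A | f v = 0}) := by
  have hmin : convexHull ℝ A ⊆
      {x | f x ≤ 0 ∧ (f x = 0 → x ∈ convexHull ℝ {v ∈ A | f v = 0})} := by
    refine convexHull_min (fun v hv => ⟨hA v hv, fun h => subset_convexHull ℝ _ ⟨hv, h⟩⟩) ?_
    rintro v ⟨hv, hv'⟩ w ⟨hw, hw'⟩ s t hs ht hst
    have hval := hf v w s t hst
    refine ⟨by rw [hval]; nlinarith, fun h0 => ?_⟩
    rcases hs.eq_or_lt with rfl | hs'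
    · obtain rfl : t = 1 := by linarith
      simp only [zero_smul, one_smul, zero_add] at h0 ⊢
      exact hw' h0
    rcases ht.eq_or_lt with rfl | ht'
    · obtain rfl : s = 1 := by linarith
      simp only [zero_smul, one_smul, add_zero] at h0 ⊢
      exact hv' h0
    have h1 : s * f v ≤ 0 := mul_nonpos_of_nonneg_of_nonpos hs hv
    have h2 : t * f w ≤ 0 := mul_nonpos_of_nonneg_of_nonpos ht hw
    have hv0 : f v = 0 := by
      have : s * f v = 0 := by linarith
      exact (mul_eq_zero.1 this).resolve_left hs'.ne'
    have hw0 : f w = 0 := by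
      have : t * f w = 0 := by linarith
      exact (mul_eq_zero.1 this).resolve_left ht'.ne'
    exact convex_convexHull ℝ _ (hv' hv0) (hw' hw0) hs ht hst
  exact hmin hx

theorem MeetsInFace.of_separated_of_faces {A B : Set (Fin 3 → ℝ)} (f : (Fin 3 → ℝ) → ℝ)
    (hf : PreservesAffine f) (hA : ∀ v ∈ A, f v ≤ 0) (hB : ∀ v ∈ B, 0 ≤ f v)
    (h : MeetsInFace {v ∈ A | f v = 0} {v ∈ B | f v = 0}) : MeetsInFace A B := by
  rintro x ⟨hxA, hxB⟩
  obtain ⟨h1, h2⟩ := hf.mem_face hA hxA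
  obtain ⟨h3, h4⟩ := hf.neg.mem_face (A := B) (fun v hv => by simpa using hB v hv) hxB
  have h0 : f x = 0 := by linarith
  simp only [neg_eq_zero] at h4
  refine convexHull_mono ?_ (h ⟨h2 h0, h4 h0⟩)
  rintro v ⟨hv, hv'⟩
  exact ⟨hv.1, hv'.1⟩

theorem MeetsInFace.of_separated {A B : Set (Fin 3 → ℝ)} (f : (Fin 3 → ℝ) → ℝ)
    (hf : PreservesAffine f) (hA : ∀ v ∈ A, f v ≤ 0) (hB : ∀ v ∈ B, 0 ≤ f v)
    (h : ∀ v ∈ B, f v = 0 → v ∈ A) : MeetsInFace A B :=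
  .of_separated_of_faces f hf hA hB (.of_subset fun v hv => ⟨h v hv.1 hv.2, hv.2⟩)

/-- Lexicographic separation by two affine functions. -/
theorem MeetsInFace.of_separated_lex {A B : Set (Fin 3 → ℝ)} (f g : (Fin 3 → ℝ) → ℝ)
    (hf : PreservesAffine f) (hg : PreservesAffine g)
    (hA : ∀ v ∈ A, f v ≤ 0) (hB : ∀ v ∈ B, 0 ≤ f v)
    (hA' : ∀ v ∈ A, f v = 0 → g v ≤ 0) (hB' : ∀ v ∈ B, f v = 0 → 0 ≤ g v)
    (h : ∀ v ∈ B, f v = 0 → g v = 0 → v ∈ A) : MeetsInFace A B :=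
  .of_separated_of_faces f hf hA hB <| .of_separated g hg (fun v hv => hA' v hv.1 hv.2)
    (fun v hv => hB' v hv.1 hv.2) fun v hv h0 => ⟨h v hv.1 hv.2 h0, hv.2⟩

theorem mem_convexHull_four {a b c d x : Fin 3 → ℝ} (w₀ w₁ w₂ w₃ : ℝ) (h₀ : 0 ≤ w₀) (h₁ : 0 ≤ w₁)
    (h₂ : 0 ≤ w₂) (h₃ : 0 ≤ w₃) (hw : w₀ + w₁ + w₂ + w₃ = 1)
    (hx : ∀ i, x i = w₀ * a i + w₁ * b i + w₂ * c i + w₃ * d i) :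
    x ∈ convexHull ℝ ({a, b, c, d} : Set (Fin 3 → ℝ)) := by
  have h := (convex_convexHull ℝ ({a, b, c, d} : Set (Fin 3 → ℝ))).sum_mem
    (t := Finset.univ) (w := ![w₀, w₁, w₂, w₃]) (z := ![a, b, c, d])
    (by intro i _; fin_cases i <;> simpa) (by simpa [Fin.sum_univ_four] using hw)
    (by intro i _; apply subset_convexHull; fin_cases i <;> simp)
  convert h using 1
  ext i
  simp [Fin.sum_univ_four, hx]

/-! ### Triangulating the lattice polygon next to a chord -/

/-- Row of the lattice point with index `k`; the indices `-1` and `q + 1` share the rows of `0`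
and `q`. -/
def row (q k : ℤ) : ℤ := max 0 (min k q)

/-- Orientation determinant of the lattice points with indices `a`, `b` and `s`. It is positive
when the point `s` lies to the left of the chord from `a` to `b`. -/
def orient (X : ℤ → ℤ) (q a s b : ℤ) : ℤ :=
  (X b - X a) * (row q s - row q a) - (row q b - row q a) * (X s - X a)

/-- The linear form on `ℝ³` whose value at a lattice point of height one is `orient`. -/
def chordForm (X : ℤ → ℤ) (q a b : ℤ) (u y z : ℝ) : ℝ :=
  ((X b : ℝ) - X a) * (y - row q a * z) - ((row q b : ℝ) - row q a) * (u - X a * z)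

/-- The triple `i < m < j` of indices in `[a, b]` spans a unimodular triangle, and the points with
indices in between lie to the left of its edges. -/
structure IsChordTriangle (X : ℤ → ℤ) (q a b : ℤ) (t : ℤ × ℤ × ℤ) : Prop where
  le_fst : a ≤ t.1
  fst_lt : t.1 < t.2.1
  lt_thd : t.2.1 < t.2.2
  thd_le : t.2.2 ≤ b
  orient_eq : orient X q t.1 t.2.1 t.2.2 = 1
  left_fst : ∀ s, t.1 < s → s < t.2.1 → 0 < orient X q t.1 s t.2.1
  left_snd : ∀ s, t.2.1 < s → s < t.2.2 → 0 < orient X q t.2.1 s t.2.2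

/-- The triple `t'` comes after `t`, or lies behind one of the two short edges of `t`. -/
def Precedes (t t' : ℤ × ℤ × ℤ) : Prop :=
  t.2.2 ≤ t'.1 ∨ (t.1 ≤ t'.1 ∧ t'.2.2 ≤ t.2.1) ∨ (t.2.1 ≤ t'.1 ∧ t'.2.2 ≤ t.2.2)

/-- A nonempty chain of lattice points to the left of a primitive chord has a member at
lattice distance one from the chord. -/
theorem exists_orient_eq_one {X : ℤ → ℤ} {q a b : ℤ} (hq : 1 ≤ q) (ha : -1 ≤ a)
    (hab : a + 1 < b) (hb : b ≤ q + 1) (hcop : IsCoprime (X b - X a) (row q b - row q a))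
    (hor : ∀ s, a < s → s < b → 1 ≤ orient X q a s b ∧ orient X q a s b ≤ row q b - row q a) :
    ∃ m, a < m ∧ m < b ∧ orient X q a m b = 1 := by
  by_cases hg : row q b - row q a ≤ 1
  · have := hor (a + 1) (by omega) (by omega)
    exact ⟨a + 1, by omega, by omega, by omega⟩
  obtain ⟨c, d, hcd⟩ := hcop
  set g := row q b - row q a with hgdef
  have ht0 : 0 ≤ c % g := Int.emod_nonneg _ (by omega)
  have ht1 : c % g < g := Int.emod_lt_of_pos _ (by omega)
  have hdiv := Int.emod_add_mul_ediv c g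
  have hmod : (X b - X a) * (c % g) = 1 - g * (d + c / g * (X b - X a)) := by
    have : c % g = c - g * (c / g) := by omega
    rw [this]
    linear_combination hcd
  have htne : c % g ≠ 0 := by
    intro h0
    rw [h0, mul_zero] at hmod
    have : g ∣ 1 := ⟨d + c / g * (X b - X a), by omega⟩
    have := Int.le_of_dvd one_pos this
    omega
  have hrow : row q (row q a + c % g) = row q a + c % g := by
    unfold row at *; omega
  have h1 : a < row q a + c % g := by unfold row at *; omega
  have h2 : row q a + c % g < b := by unfold row at *; omega
  refine ⟨row q a + c % g, h1, h2, ?_⟩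
  obtain ⟨h3, h4⟩ := hor _ h1 h2
  have h5 : g ∣ orient X q a (row q a + c % g) b - 1 := by
    refine ⟨-(d + c / g * (X b - X a)) - (X (row q a + c % g) - X a), ?_⟩
    unfold orient
    rw [hrow, ← hgdef]
    linear_combination hmod
  have h6 := Int.eq_zero_of_dvd_of_nonneg_of_lt (by omega) (by omega) h5
  omega

theorem exists_chordTriangulation {X : ℤ → ℤ} {q : ℤ} (hq : 1 ≤ q) (a b : ℤ) (ha : -1 ≤ a)
    (hab : a < b) (hb : b ≤ q + 1) (hcop : IsCoprime (X b - X a) (row q b - row q a))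
    (hor : ∀ s, a < s → s < b → 1 ≤ orient X q a s b ∧ orient X q a s b ≤ row q b - row q a) :
    ∃ F : Finset (ℤ × ℤ × ℤ), (∀ t ∈ F, IsChordTriangle X q a b t) ∧
      (∀ t ∈ F, ∀ t' ∈ F, t = t' ∨ Precedes t t' ∨ Precedes t' t) ∧
      ∀ (k : ℤ) (u y z : ℝ), a ≤ k → k < b → 0 ≤ k → k < q → k * z ≤ y → y ≤ (k + 1) * z →
        0 ≤ chordForm X q a b u y z → chordForm X q k (k + 1) u y z < 0 →
        ∃ t ∈ F, 0 ≤ chordForm X q t.1 t.2.2 u y z ∧ chordForm X q t.1 t.2.1 u y z ≤ 0 ∧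
          chordForm X q t.2.1 t.2.2 u y z ≤ 0 := by
  by_cases hlen : b = a + 1
  · subst hlen
    refine ⟨∅, by simp, by simp, ?_⟩
    intro k u y z h1 h2 _ _ _ _ h3 h4
    obtain rfl : k = a := by omega
    exact absurd h3 (not_le.2 h4)
  obtain ⟨m, ham, hmb, hm⟩ := exists_orient_eq_one hq ha (by omega) hb hcop hor
  have hg : 0 < row q b - row q a := by unfold row; omega
  have hor₁ : ∀ s, a < s → s < m →
      1 ≤ orient X q a s m ∧ orient X q a s m ≤ row q m - row q a := by
    intro s hs hs'
    obtain ⟨h1, h2⟩ := hor s hs (by omega)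
    have hid : (row q b - row q a) * orient X q a s m =
        (row q m - row q a) * orient X q a s b - (row q s - row q a) * orient X q a m b := by
      unfold orient; ring
    have h3 : row q s < row q m := by unfold row; omega
    have h4 : 0 ≤ row q s - row q a := by unfold row; omega
    rw [hm] at hid
    refine ⟨pos_of_mul_pos_right (a := row q b - row q a) ?_ hg.le,
      le_of_mul_le_mul_left (a := row q b - row q a) ?_ hg⟩ <;> nlinarith
  have hor₂ : ∀ s, m < s → s < b →
      1 ≤ orient X q m s b ∧ orient X q m s b ≤ row q b - row q m := by
    intro s hs hs'
    obtain ⟨h1, h2⟩ := hor s (by omega) hs'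
    have hid : (row q b - row q a) * orient X q m s b =
        (row q b - row q m) * orient X q a s b - (row q b - row q s) * orient X q a m b := by
      unfold orient; ring
    have h3 : row q m < row q s := by unfold row; omega
    have h4 : 0 ≤ row q b - row q s := by unfold row; omega
    rw [hm] at hid
    refine ⟨pos_of_mul_pos_right (a := row q b - row q a) ?_ hg.le,
      le_of_mul_le_mul_left (a := row q b - row q a) ?_ hg⟩ <;> nlinarith
  obtain ⟨F₁, hF₁, hL₁, hC₁⟩ := exists_chordTriangulation (X := X) hq a m ha ham (by omega)
    ⟨-(row q b - row q a), X b - X a, by unfold orient at hm; linear_combination hm⟩ hor₁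
  obtain ⟨F₂, hF₂, hL₂, hC₂⟩ := exists_chordTriangulation (X := X) hq m b (by omega) hmb hb
    ⟨row q b - row q a, -(X b - X a), by unfold orient at hm; linear_combination hm⟩ hor₂
  have hmul : ∀ {c d : ℤ} {t : ℤ × ℤ × ℤ}, a ≤ c → d ≤ b → IsChordTriangle X q c d t →
      IsChordTriangle X q a b t := fun hc hd ht =>
    ⟨hc.trans ht.le_fst, ht.fst_lt, ht.lt_thd, ht.thd_le.trans hd, ht.orient_eq, ht.left_fst,
      ht.left_snd⟩
  refine ⟨insert (a, m, b) (F₁ ∪ F₂), ?_, ?_, ?_⟩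
  · intro t ht
    simp only [Finset.mem_insert, Finset.mem_union] at ht
    rcases ht with rfl | ht | ht
    · refine ⟨le_rfl, ham, hmb, le_rfl, hm, fun s h1 h2 => ?_, fun s h1 h2 => ?_⟩
      · exact (hor₁ s h1 h2).1
      · exact (hor₂ s h1 h2).1
    · exact hmul le_rfl hmb.le (hF₁ t ht)
    · exact hmul ham.le le_rfl (hF₂ t ht)
  · intro t ht t' ht'
    simp only [Finset.mem_insert, Finset.mem_union] at ht ht'
    have key₁ : ∀ t ∈ F₁, a ≤ t.1 ∧ t.2.2 ≤ m := fun t h => ⟨(hF₁ t h).le_fst, (hF₁ t h).thd_le⟩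
    have key₂ : ∀ t ∈ F₂, m ≤ t.1 ∧ t.2.2 ≤ b := fun t h => ⟨(hF₂ t h).le_fst, (hF₂ t h).thd_le⟩
    rcases ht with rfl | ht | ht <;> rcases ht' with rfl | ht' | ht'
    · exact .inl rfl
    · exact .inr (.inl (.inr (.inl (key₁ _ ht'))))
    · exact .inr (.inl (.inr (.inr (key₂ _ ht'))))
    · exact .inr (.inr (.inr (.inl (key₁ _ ht))))
    · exact hL₁ t ht t' ht'
    · exact .inr (.inl (.inl ((key₁ _ ht).2.trans (key₂ _ ht').1)))
    · exact .inr (.inr (.inr (.inr (key₂ _ ht))))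
    · exact .inr (.inr (.inl ((key₁ _ ht').2.trans (key₂ _ ht).1)))
    · exact hL₂ t ht t' ht'
  · intro k u y z h1 h2 h3 h4 h5 h6 h7 h8
    have hz : 0 ≤ z := by linarith
    have hid : (orient X q a m b : ℝ) * (y - row q m * z) =
        ((row q m : ℝ) - row q a) * chordForm X q m b u y z -
          ((row q b : ℝ) - row q m) * chordForm X q a m u y z := by
      unfold chordForm orient; push_cast; ring
    rw [hm, Int.cast_one, one_mul] at hid
    have ham' : (row q a : ℝ) ≤ row q m := by
      exact_mod_cast (by unfold row; omega : row q a ≤ row q m)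
    have hmb' : (row q m : ℝ) ≤ row q b := by
      exact_mod_cast (by unfold row; omega : row q m ≤ row q b)
    rcases lt_or_ge k m with hk | hk
    · rcases le_or_gt 0 (chordForm X q a m u y z) with hc | hc
      · obtain ⟨t, ht, h⟩ := hC₁ k u y z h1 hk h3 h4 h5 h6 hc h8
        exact ⟨t, by simp [ht], h⟩
      · have hlt : (row q a : ℝ) < row q m := by
          exact_mod_cast (by unfold row; omega : row q a < row q m)
        have hk1 : (k : ℝ) + 1 ≤ row q m := by
          exact_mod_cast (by unfold row; omega : k + 1 ≤ row q m)
        refine ⟨(a, m, b), by simp, h7, hc.le, ?_⟩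
        by_contra! hpos
        have := mul_pos (sub_pos.2 hlt) hpos
        have := mul_nonneg (sub_nonneg.2 hmb') (neg_nonneg.2 hc.le)
        nlinarith
    · rcases le_or_gt 0 (chordForm X q m b u y z) with hc | hc
      · obtain ⟨t, ht, h⟩ := hC₂ k u y z hk h2 h3 h4 h5 h6 hc h8
        exact ⟨t, by simp [ht], h⟩
      · have hlt : (row q m : ℝ) < row q b := by
          exact_mod_cast (by unfold row; omega : row q m < row q b)
        have hk1 : (row q m : ℝ) ≤ k := by
          exact_mod_cast (by unfold row; omega : row q m ≤ k)
        refine ⟨(a, m, b), by simp, h7, ?_, hc.le⟩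
        by_contra! hpos
        have := mul_pos (sub_pos.2 hlt) hpos
        have := mul_nonneg (sub_nonneg.2 ham') (neg_nonneg.2 hc.le)
        nlinarith
termination_by (b - a).toNat
decreasing_by all_goals omega

/-! ### The cells in doubled coordinates -/

/-- The lattice point `(e, 0, 0)` on the bottom edge. -/
def basePt (e : ℤ) : Fin 3 → ℝ := ![e, 0, 0]

/-- The lattice point of height one with index `k`. -/
def topPt (x : ℤ → ℤ) (q k : ℤ) : Fin 3 → ℝ := ![x k, row q k, 1]

/-- The pyramid with apex `(α, 0, 0)` over a triangle of height one. -/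
def pyramid (α : ℤ) (x : ℤ → ℤ) (q : ℤ) (t : ℤ × ℤ × ℤ) : Set (Fin 3 → ℝ) :=
  {basePt α, topPt x q t.1, topPt x q t.2.1, topPt x q t.2.2}

/-- The join of a unit segment of the bottom edge and a step of the lattice path. -/
def pathJoin (x : ℤ → ℤ) (q e k : ℤ) : Set (Fin 3 → ℝ) :=
  {basePt e, basePt (e + 1), topPt x q k, topPt x q (k + 1)}

/-- The first coordinate, sheared so that it vanishes at `(α, 0, 0)`, and reflected if `ε = -1`. -/
def sideCoord (ε α : ℤ) (v : Fin 3 → ℝ) : ℝ := ε * (v 0 - α * (1 - v 2))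

/-- The affine function on `ℝ³` that vanishes on the plane through `(α, 0, 0)` and the points of
height one with indices `a` and `b`. -/
def sideForm (ε α : ℤ) (x : ℤ → ℤ) (q a b : ℤ) (v : Fin 3 → ℝ) : ℝ :=
  chordForm (fun k => ε * x k) q a b (sideCoord ε α v) (v 1) (v 2)

theorem sideCoord_preservesAffine (ε α : ℤ) (c : ℝ) :
    PreservesAffine fun v => sideCoord ε α v - c * v 2 := by
  intro v w s t hst
  obtain rfl : t = 1 - s := by linarith
  simp [sideCoord]
  ring

theorem sideForm_preservesAffine (ε α : ℤ) (x : ℤ → ℤ) (q a b : ℤ) :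
    PreservesAffine (sideForm ε α x q a b) := by
  intro v w s t hst
  obtain rfl : t = 1 - s := by linarith
  simp [sideForm, chordForm, sideCoord]
  ring

theorem rowForm_preservesAffine (c : ℝ) : PreservesAffine fun v => v 1 - c * v 2 := by
  intro v w s t hst
  simp
  ring

theorem sideForm_topPt (ε α : ℤ) (x : ℤ → ℤ) (q a b s : ℤ) :
    sideForm ε α x q a b (topPt x q s) = orient (fun k => ε * x k) q a s b := by
  simp [sideForm, chordForm, sideCoord, topPt, orient]

theorem sideForm_basePt (ε α : ℤ) (x : ℤ → ℤ) (q a b e : ℤ) :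
    sideForm ε α x q a b (basePt e) = -(((row q b : ℝ) - row q a) * (ε * (e - α))) := by
  simp [sideForm, chordForm, sideCoord, basePt]

theorem orient_left (X : ℤ → ℤ) (q a b : ℤ) : orient X q a a b = 0 := by
  unfold orient; ring

theorem orient_right (X : ℤ → ℤ) (q a b : ℤ) : orient X q a b b = 0 := by
  unfold orient; ring

theorem orient_swap_right (X : ℤ → ℤ) (q a s b : ℤ) : orient X q a b s = -orient X q a s b := by
  unfold orient; ring

theorem orient_swap_left (X : ℤ → ℤ) (q a s b : ℤ) : orient X q s a b = -orient X q a s b := by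
  unfold orient; ring

/-- The two admissible pairs of a reflection sign and an apex. -/
def IsSide (ε α : ℤ) : Prop := (ε = -1 ∧ α = 0) ∨ (ε = 1 ∧ α = 2)

theorem IsSide.mul_nonpos {ε α e : ℤ} (h : IsSide ε α) (he : 0 ≤ e) (he' : e ≤ 2) :
    (ε : ℝ) * (e - α) ≤ 0 := by
  have : ε * (e - α) ≤ 0 := by rcases h with ⟨rfl, rfl⟩ | ⟨rfl, rfl⟩ <;> omega
  exact_mod_cast this

theorem IsSide.eq_of_mul_eq_zero {ε α e : ℤ} (h : IsSide ε α) (h0 : (ε : ℝ) * (e - α) = 0) :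
    e = α := by
  have : ε * (e - α) = 0 := by exact_mod_cast h0
  rcases h with ⟨rfl, rfl⟩ | ⟨rfl, rfl⟩ <;> omega

section Separation

variable {ε α : ℤ} {x : ℤ → ℤ} {q a b : ℤ} {t : ℤ × ℤ × ℤ} {B : Set (Fin 3 → ℝ)}

theorem pyramid_meets_after (hs : IsSide ε α) (ha : -1 ≤ a)
    (ht : IsChordTriangle (fun k => ε * x k) q a b t) (hq : t.2.2 < q)
    (hB : ∀ v ∈ B, (∃ e, 0 ≤ e ∧ e ≤ 2 ∧ v = basePt e) ∨ ∃ s, t.2.2 ≤ s ∧ v = topPt x q s) :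
    MeetsInFace (pyramid α x q t) B := by
  obtain ⟨h1, h2, h3, h4, -, -, -⟩ := ht
  have hi : row q t.1 < row q t.2.2 := by unfold row; omega
  have hm : row q t.2.1 < row q t.2.2 := by unfold row; omega
  refine .of_separated_lex (fun v => v 1 - (row q t.2.2 : ℝ) * v 2)
    (fun v => -(sideCoord ε α v - (ε * x t.2.2 : ℝ) * v 2))
    (rowForm_preservesAffine _) (sideCoord_preservesAffine _ _ _).neg ?_ ?_ ?_ ?_ ?_
  · rintro v (rfl | rfl | rfl | rfl)
    · simp [basePt]
    · simpa [topPt] using hi.le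
    · simpa [topPt] using hm.le
    · simp [topPt]
  · intro v hv
    obtain ⟨e, -, -, rfl⟩ | ⟨s, hs, rfl⟩ := hB v hv
    · simp [basePt]
    · have : row q t.2.2 ≤ row q s := by unfold row; omega
      simpa [topPt] using this
  · rintro v (rfl | rfl | rfl | rfl) h0
    · simp [basePt, sideCoord]
    · simp [topPt, sub_eq_zero] at h0; omega
    · simp [topPt, sub_eq_zero] at h0; omega
    · simp [topPt, sideCoord]
  · intro v hv h0
    obtain ⟨e, he, he', rfl⟩ | ⟨s, hs', rfl⟩ := hB v hv
    · simpa [basePt, sideCoord] using hs.mul_nonpos he he'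
    · simp [topPt, sub_eq_zero] at h0
      obtain rfl : s = t.2.2 := by unfold row at *; omega
      simp [topPt, sideCoord]
  · intro v hv h0 h0'
    obtain ⟨e, he, he', rfl⟩ | ⟨s, hs', rfl⟩ := hB v hv
    · obtain rfl := hs.eq_of_mul_eq_zero (e := e) (by simpa [basePt, sideCoord] using h0')
      simp [pyramid]
    · simp [topPt, sub_eq_zero] at h0
      obtain rfl : s = t.2.2 := by unfold row at *; omega
      simp [pyramid]

theorem pyramid_meets_before (hs : IsSide ε α) (hb : b ≤ q + 1)
    (ht : IsChordTriangle (fun k => ε * x k) q a b t) (hq : 0 < t.1)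
    (hB : ∀ v ∈ B, (∃ e, 0 ≤ e ∧ e ≤ 2 ∧ v = basePt e) ∨ ∃ s, s ≤ t.1 ∧ v = topPt x q s) :
    MeetsInFace (pyramid α x q t) B := by
  obtain ⟨h1, h2, h3, h4, -, -, -⟩ := ht
  have hj : row q t.1 < row q t.2.2 := by unfold row; omega
  have hm : row q t.1 < row q t.2.1 := by unfold row; omega
  refine .of_separated_lex (fun v => -(v 1 - (row q t.1 : ℝ) * v 2))
    (fun v => -(sideCoord ε α v - (ε * x t.1 : ℝ) * v 2))
    (rowForm_preservesAffine _).neg (sideCoord_preservesAffine _ _ _).neg ?_ ?_ ?_ ?_ ?_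
  · rintro v (rfl | rfl | rfl | rfl)
    · simp [basePt]
    · simp [topPt]
    · simpa [topPt] using hm.le
    · simpa [topPt] using hj.le
  · intro v hv
    obtain ⟨e, -, -, rfl⟩ | ⟨s, hs, rfl⟩ := hB v hv
    · simp [basePt]
    · have : row q s ≤ row q t.1 := by unfold row; omega
      simpa [topPt] using this
  · rintro v (rfl | rfl | rfl | rfl) h0
    · simp [basePt, sideCoord]
    · simp [topPt, sideCoord]
    · simp [topPt, sub_eq_zero] at h0; omega
    · simp [topPt, sub_eq_zero] at h0; omega
  · intro v hv h0
    obtain ⟨e, he, he', rfl⟩ | ⟨s, hs', rfl⟩ := hB v hv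
    · simpa [basePt, sideCoord] using hs.mul_nonpos he he'
    · simp [topPt, sub_eq_zero] at h0
      obtain rfl : s = t.1 := by unfold row at *; omega
      simp [topPt, sideCoord]
  · intro v hv h0 h0'
    obtain ⟨e, he, he', rfl⟩ | ⟨s, hs', rfl⟩ := hB v hv
    · obtain rfl := hs.eq_of_mul_eq_zero (e := e) (by simpa [basePt, sideCoord] using h0')
      simp [pyramid]
    · simp [topPt, sub_eq_zero] at h0
      obtain rfl : s = t.1 := by unfold row at *; omega
      simp [pyramid]

theorem sideForm_nonpos_fst (ht : IsChordTriangle (fun k => ε * x k) q a b t) :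
    ∀ v ∈ pyramid α x q t, sideForm ε α x q t.1 t.2.1 v ≤ 0 := by
  rintro v (rfl | rfl | rfl | rfl)
  · simp [sideForm_basePt]
  · simp [sideForm_topPt, orient_left]
  · simp [sideForm_topPt, orient_right]
  · rw [sideForm_topPt, orient_swap_right, ht.orient_eq]; simp

theorem sideForm_nonpos_snd (ht : IsChordTriangle (fun k => ε * x k) q a b t) :
    ∀ v ∈ pyramid α x q t, sideForm ε α x q t.2.1 t.2.2 v ≤ 0 := by
  rintro v (rfl | rfl | rfl | rfl)
  · simp [sideForm_basePt]
  · rw [sideForm_topPt, orient_swap_left, ht.orient_eq]; simp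
  · simp [sideForm_topPt, orient_left]
  · simp [sideForm_topPt, orient_right]

theorem pyramid_meets_behind {c d : ℤ} (hs : IsSide ε α)
    (hpyr : ∀ v ∈ pyramid α x q t, sideForm ε α x q c d v ≤ 0)
    (hleft : ∀ s, c < s → s < d → 0 < orient (fun k => ε * x k) q c s d)
    (hc : topPt x q c ∈ pyramid α x q t) (hd : topPt x q d ∈ pyramid α x q t)
    (hrow : row q c < row q d)
    (hB : ∀ v ∈ B, (∃ e, 0 ≤ e ∧ e ≤ 2 ∧ v = basePt e) ∨ ∃ s, c ≤ s ∧ s ≤ d ∧ v = topPt x q s) :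
    MeetsInFace (pyramid α x q t) B := by
  have hrow' : (0 : ℝ) < (row q d : ℝ) - row q c := by exact_mod_cast sub_pos.2 hrow
  refine .of_separated _ (sideForm_preservesAffine ε α x q c d) hpyr ?_ ?_
  · intro v hv
    obtain ⟨e, he, he', rfl⟩ | ⟨s, hs, hs', rfl⟩ := hB v hv
    · rw [sideForm_basePt]
      have := hs.mul_nonpos he he'
      nlinarith
    · rw [sideForm_topPt]
      rcases hs.eq_or_lt with rfl | h
      · simp [orient_left]
      rcases hs'.eq_or_lt with rfl | h'
      · simp [orient_right]
      exact_mod_cast (hleft s h h').le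
  · intro v hv h0
    obtain ⟨e, he, he', rfl⟩ | ⟨s, hs, hs', rfl⟩ := hB v hv
    · rw [sideForm_basePt, neg_eq_zero, mul_eq_zero] at h0
      obtain rfl := hs.eq_of_mul_eq_zero (h0.resolve_left hrow'.ne')
      simp [pyramid]
    · rw [sideForm_topPt] at h0
      rcases hs.eq_or_lt with rfl | h
      · exact hc
      rcases hs'.eq_or_lt with rfl | h'
      · exact hd
      have := hleft s h h'
      have : orient (fun k => ε * x k) q c s d = 0 := by exact_mod_cast h0
      omega

theorem pyramid_meets_pyramid (hs : IsSide ε α) (ha : -1 ≤ a) (hb : b ≤ q + 1)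
    {t' : ℤ × ℤ × ℤ} (ht : IsChordTriangle (fun k => ε * x k) q a b t)
    (ht' : IsChordTriangle (fun k => ε * x k) q a b t') (h : Precedes t t') :
    MeetsInFace (pyramid α x q t) (pyramid α x q t') := by
  have hα : 0 ≤ α ∧ α ≤ 2 := by rcases hs with ⟨-, rfl⟩ | ⟨-, rfl⟩ <;> omega
  obtain ⟨h1, h2, h3, h4, -, h5, h6⟩ := id ht
  obtain ⟨h1', h2', h3', h4', -, -, -⟩ := ht'
  rcases h with h | h | h
  · refine pyramid_meets_after hs ha ht (by omega) ?_
    rintro v (rfl | rfl | rfl | rfl)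
    · exact .inl ⟨α, hα.1, hα.2, rfl⟩
    · exact .inr ⟨_, by omega, rfl⟩
    · exact .inr ⟨_, by omega, rfl⟩
    · exact .inr ⟨_, by omega, rfl⟩
  · refine pyramid_meets_behind hs (sideForm_nonpos_fst ht) h5 (by simp [pyramid])
      (by simp [pyramid]) (by unfold row; omega) ?_
    rintro v (rfl | rfl | rfl | rfl)
    · exact .inl ⟨α, hα.1, hα.2, rfl⟩
    · exact .inr ⟨_, by omega, by omega, rfl⟩
    · exact .inr ⟨_, by omega, by omega, rfl⟩
    · exact .inr ⟨_, by omega, by omega, rfl⟩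
  · refine pyramid_meets_behind hs (sideForm_nonpos_snd ht) h6 (by simp [pyramid])
      (by simp [pyramid]) (by unfold row; omega) ?_
    rintro v (rfl | rfl | rfl | rfl)
    · exact .inl ⟨α, hα.1, hα.2, rfl⟩
    · exact .inr ⟨_, by omega, by omega, rfl⟩
    · exact .inr ⟨_, by omega, by omega, rfl⟩
    · exact .inr ⟨_, by omega, by omega, rfl⟩

theorem pyramid_meets_pathJoin (hs : IsSide ε α) (ha : -1 ≤ a) (hb : b ≤ q + 1)
    (ht : IsChordTriangle (fun k => ε * x k) q a b t) {e k : ℤ} (he : 0 ≤ e) (he' : e ≤ 1)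
    (hk : 0 ≤ k) (hk' : k < q) : MeetsInFace (pyramid α x q t) (pathJoin x q e k) := by
  obtain ⟨h1, h2, h3, h4, -, h5, h6⟩ := id ht
  have hcase : t.2.2 ≤ k ∨ k + 1 ≤ t.1 ∨ (t.1 ≤ k ∧ k + 1 ≤ t.2.1) ∨
      (t.2.1 ≤ k ∧ k + 1 ≤ t.2.2) := by omega
  rcases hcase with h | h | h | h
  · refine pyramid_meets_after hs ha ht (by omega) ?_
    rintro v (rfl | rfl | rfl | rfl)
    · exact .inl ⟨e, by omega, by omega, rfl⟩
    · exact .inl ⟨e + 1, by omega, by omega, rfl⟩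
    · exact .inr ⟨_, by omega, rfl⟩
    · exact .inr ⟨_, by omega, rfl⟩
  · refine pyramid_meets_before hs hb ht (by omega) ?_
    rintro v (rfl | rfl | rfl | rfl)
    · exact .inl ⟨e, by omega, by omega, rfl⟩
    · exact .inl ⟨e + 1, by omega, by omega, rfl⟩
    · exact .inr ⟨_, by omega, rfl⟩
    · exact .inr ⟨_, by omega, rfl⟩
  · refine pyramid_meets_behind hs (sideForm_nonpos_fst ht) h5 (by simp [pyramid])
      (by simp [pyramid]) (by unfold row; omega) ?_
    rintro v (rfl | rfl | rfl | rfl)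
    · exact .inl ⟨e, by omega, by omega, rfl⟩
    · exact .inl ⟨e + 1, by omega, by omega, rfl⟩
    · exact .inr ⟨_, by omega, by omega, rfl⟩
    · exact .inr ⟨_, by omega, by omega, rfl⟩
  · refine pyramid_meets_behind hs (sideForm_nonpos_snd ht) h6 (by simp [pyramid])
      (by simp [pyramid]) (by unfold row; omega) ?_
    rintro v (rfl | rfl | rfl | rfl)
    · exact .inl ⟨e, by omega, by omega, rfl⟩
    · exact .inl ⟨e + 1, by omega, by omega, rfl⟩
    · exact .inr ⟨_, by omega, by omega, rfl⟩
    · exact .inr ⟨_, by omega, by omega, rfl⟩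

/-- A point of a pyramid in the strip between the rows `k` and `k + 1` lies on the same side of
the lattice path as the pyramid. -/
theorem sideForm_path_nonpos (ht : IsChordTriangle (fun k => ε * x k) q a b t)
    {k : ℤ} (hk : 0 ≤ k) (hk' : k < q) (hik : t.1 ≤ k) (hkj : k < t.2.2) {v : Fin 3 → ℝ}
    (hv : v ∈ convexHull ℝ (pyramid α x q t)) (h1 : k * v 2 ≤ v 1) (h2 : v 1 ≤ (k + 1) * v 2) :
    sideForm ε α x q k (k + 1) v ≤ 0 := by
  have aux : ∀ c d : ℤ, (∀ v ∈ pyramid α x q t, sideForm ε α x q c d v ≤ 0) →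
      (∀ s, c < s → s < d → 0 < orient (fun k => ε * x k) q c s d) → c ≤ k → k < d →
      sideForm ε α x q k (k + 1) v ≤ 0 := by
    intro c d hpyr hleft hck hkd
    have hnn : ∀ s, c ≤ s → s ≤ d → 0 ≤ orient (fun k => ε * x k) q c s d := by
      intro s hs hs'
      rcases hs.eq_or_lt with rfl | h
      · simp [orient_left]
      rcases hs'.eq_or_lt with rfl | h'
      · simp [orient_right]
      exact (hleft s h h').le
    have hrow : row q c < row q d := by unfold row; omega
    have hrow' : (0 : ℝ) < (row q d : ℝ) - row q c := by exact_mod_cast sub_pos.2 hrow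
    have hle := ((sideForm_preservesAffine ε α x q c d).mem_face hpyr hv).1
    have hk0 : row q k = k := by unfold row; omega
    have hk1 : row q (k + 1) = k + 1 := by unfold row; omega
    have hid : sideForm ε α x q c d v =
        ((row q d : ℝ) - row q c) * sideForm ε α x q k (k + 1) v +
          ((k + 1) * v 2 - v 1) * (orient (fun k => ε * x k) q c k d : ℝ) +
          (v 1 - k * v 2) * (orient (fun k => ε * x k) q c (k + 1) d : ℝ) := by
      unfold sideForm chordForm orient
      rw [hk0, hk1]
      push_cast
      ring
    have h3 : (0 : ℝ) ≤ (orient (fun k => ε * x k) q c k d : ℝ) := by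
      exact_mod_cast hnn k hck hkd.le
    have h4 : (0 : ℝ) ≤ (orient (fun k => ε * x k) q c (k + 1) d : ℝ) := by
      exact_mod_cast hnn (k + 1) (by omega) (by omega)
    have h5 := mul_nonneg (sub_nonneg.2 h2) h3
    have h6 := mul_nonneg (sub_nonneg.2 h1) h4
    by_contra! hpos
    have := mul_pos hrow' hpos
    linarith
  rcases lt_or_ge k t.2.1 with h | h
  · exact aux _ _ (sideForm_nonpos_fst ht) ht.left_fst hik h
  · exact aux _ _ (sideForm_nonpos_snd ht) ht.left_snd h hkj

end Separation

theorem heightForm_preservesAffine : PreservesAffine fun v => v 2 - 1 := by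
  intro v w s t hst
  simp
  linear_combination hst

theorem pathJoin_meets_of_lt {x : ℤ → ℤ} {q e k e' k' : ℤ} (he : 0 ≤ e) (he₁ : e ≤ 1)
    (he' : 0 ≤ e') (he₁' : e' ≤ 1) (hk : 0 ≤ k) (hkk : k < k') (hk' : k' < q) :
    MeetsInFace (pathJoin x q e k) (pathJoin x q e' k') := by
  have r0 : row q k = k := by unfold row; omega
  have r1 : row q (k + 1) = k + 1 := by unfold row; omega
  have r0' : row q k' = k' := by unfold row; omega
  have r1' : row q (k' + 1) = k' + 1 := by unfold row; omega
  have hlt : (k : ℝ) < k' := by exact_mod_cast hkk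
  have hle : (k : ℝ) + 1 ≤ k' := by exact_mod_cast hkk
  have hA : ∀ v ∈ pathJoin x q e k, v 1 - (k' : ℝ) * v 2 ≤ 0 := by
    rintro v (rfl | rfl | rfl | rfl)
    · simp [basePt]
    · simp [basePt]
    · simpa [topPt, r0] using hlt.le
    · simpa [topPt, r1] using hle
  have hB : ∀ v ∈ pathJoin x q e' k', 0 ≤ v 1 - (k' : ℝ) * v 2 := by
    rintro v (rfl | rfl | rfl | rfl)
    · simp [basePt]
    · simp [basePt]
    · simp [topPt, r0']
    · simp [topPt, r1']
  have zA : ∀ v ∈ pathJoin x q e k, v 1 - (k' : ℝ) * v 2 = 0 →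
      v = basePt e ∨ v = basePt (e + 1) ∨ v = topPt x q k' := by
    rintro v (rfl | rfl | rfl | rfl) h0
    · simp
    · simp
    · simp [topPt, r0] at h0; linarith
    · simp [topPt, r1] at h0
      obtain rfl : k' = k + 1 := by
        have : (k' : ℝ) = (k + 1 : ℤ) := by push_cast; linarith
        exact_mod_cast this
      simp
  have zB : ∀ v ∈ pathJoin x q e' k', v 1 - (k' : ℝ) * v 2 = 0 →
      v = basePt e' ∨ v = basePt (e' + 1) ∨ v = topPt x q k' := by
    rintro v (rfl | rfl | rfl | rfl) h0
    · simp
    · simp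
    · simp
    · simp [topPt, r1'] at h0
  have hf := rowForm_preservesAffine (k' : ℝ)
  rcases lt_trichotomy e e' with h | rfl | h
  · obtain rfl : e = 0 := by omega
    obtain rfl : e' = 1 := by omega
    refine MeetsInFace.symm <| .of_separated_lex (fun v => -(v 1 - (k' : ℝ) * v 2))
      (fun v => -(sideCoord 1 1 v - (x k' : ℝ) * v 2)) hf.neg
      (sideCoord_preservesAffine _ _ _).neg (fun v hv => neg_nonpos.2 (hB v hv))
      (fun v hv => neg_nonneg.2 (hA v hv)) ?_ ?_ ?_
    · intro v hv h0
      rcases zB v hv (neg_eq_zero.1 h0) with rfl | rfl | rfl <;>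
        simp [basePt, topPt, sideCoord]
    · intro v hv h0
      rcases zA v hv (neg_eq_zero.1 h0) with rfl | rfl | rfl <;>
        simp [basePt, topPt, sideCoord]
    · intro v hv h0 h1
      rcases zA v hv (neg_eq_zero.1 h0) with rfl | rfl | rfl
      · simp [basePt, sideCoord] at h1
      · simp [pathJoin]
      · simp [pathJoin]
  · refine MeetsInFace.symm <| .of_separated (fun v => -(v 1 - (k' : ℝ) * v 2)) hf.neg
      (fun v hv => neg_nonpos.2 (hB v hv)) (fun v hv => neg_nonneg.2 (hA v hv)) ?_
    intro v hv h0
    rcases zA v hv (neg_eq_zero.1 h0) with rfl | rfl | rfl <;> simp [pathJoin]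
  · obtain rfl : e' = 0 := by omega
    obtain rfl : e = 1 := by omega
    refine MeetsInFace.symm <| .of_separated_lex (fun v => -(v 1 - (k' : ℝ) * v 2))
      (fun v => sideCoord 1 1 v - (x k' : ℝ) * v 2) hf.neg
      (sideCoord_preservesAffine _ _ _) (fun v hv => neg_nonpos.2 (hB v hv))
      (fun v hv => neg_nonneg.2 (hA v hv)) ?_ ?_ ?_
    · intro v hv h0
      rcases zB v hv (neg_eq_zero.1 h0) with rfl | rfl | rfl <;>
        simp [basePt, topPt, sideCoord]
    · intro v hv h0
      rcases zA v hv (neg_eq_zero.1 h0) with rfl | rfl | rfl <;>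
        simp [basePt, topPt, sideCoord]
    · intro v hv h0 h1
      rcases zA v hv (neg_eq_zero.1 h0) with rfl | rfl | rfl
      · simp [pathJoin]
      · simp [basePt, sideCoord] at h1
        norm_num at h1
      · simp [pathJoin]

theorem pathJoin_meets_same_step (x : ℤ → ℤ) {q k : ℤ} (hk : 0 ≤ k) (hk' : k < q) :
    MeetsInFace (pathJoin x q 0 k) (pathJoin x q 1 k) := by
  have r0 : row q k = k := by unfold row; omega
  have r1 : row q (k + 1) = k + 1 := by unfold row; omega
  refine .of_separated (fun v => -sideForm 1 1 x q k (k + 1) v)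
    (sideForm_preservesAffine 1 1 x q k (k + 1)).neg ?_ ?_ ?_
  · rintro v (rfl | rfl | rfl | rfl) <;>
      simp [sideForm_basePt, sideForm_topPt, orient_left, orient_right, r0, r1]
  · rintro v (rfl | rfl | rfl | rfl) <;>
      simp [sideForm_basePt, sideForm_topPt, orient_left, orient_right, r0, r1]
  · rintro v (rfl | rfl | rfl | rfl) <;>
      norm_num [sideForm_basePt, sideForm_topPt, orient_left, orient_right, r0, r1, pathJoin]

theorem pathJoin_meets_pathJoin {x : ℤ → ℤ} {q e k e' k' : ℤ} (he : 0 ≤ e) (he₁ : e ≤ 1)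
    (he' : 0 ≤ e') (he₁' : e' ≤ 1) (hk : 0 ≤ k) (hk₁ : k < q) (hk' : 0 ≤ k') (hk₁' : k' < q) :
    MeetsInFace (pathJoin x q e k) (pathJoin x q e' k') := by
  rcases lt_trichotomy k k' with h | rfl | h
  · exact pathJoin_meets_of_lt he he₁ he' he₁' hk h hk₁'
  · rcases lt_trichotomy e e' with h | rfl | h
    · obtain rfl : e = 0 := by omega
      obtain rfl : e' = 1 := by omega
      exact pathJoin_meets_same_step x hk hk₁
    · exact .of_subset subset_rfl
    · obtain rfl : e' = 0 := by omega
      obtain rfl : e = 1 := by omega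
      exact (pathJoin_meets_same_step x hk hk₁).symm
  · exact (pathJoin_meets_of_lt he' he₁' he he₁ hk' h hk₁).symm

theorem exists_strip {a b : ℤ} (hab : a < b) {y z : ℝ} (h1 : a * z ≤ y) (h2 : y ≤ b * z) :
    ∃ k : ℤ, a ≤ k ∧ k < b ∧ k * z ≤ y ∧ y ≤ (k + 1) * z := by
  induction b, hab using Int.leInduction with
  | base => exact ⟨a, le_rfl, by omega, h1, by simpa using h2⟩
  | succ b hb ih =>
    rcases le_total y (b * z) with h | h
    · obtain ⟨k, hk, hk', h3⟩ := ih h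
      exact ⟨k, hk, by omega, h3⟩
    · exact ⟨b, by omega, by omega, h, by simpa using h2⟩

theorem MeetsInFace.of_subset_pair {A B : Set (Fin 3 → ℝ)} {p p' : Fin 3 → ℝ}
    (hA : A ⊆ {p, p'}) (hB : B ⊆ {p, p'}) : MeetsInFace A B := by
  by_cases h : B ⊆ A
  · exact .of_subset h
  by_cases h' : A ⊆ B
  · exact (MeetsInFace.of_subset h').symm
  obtain ⟨b, hb, hbA⟩ := Set.not_subset.1 h
  obtain ⟨a, ha, haB⟩ := Set.not_subset.1 h'
  have hab : a ≠ b := fun h => haB (h ▸ hb)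
  have hA' : A ⊆ {a} := by
    intro c hc
    by_contra hca
    have h1 := hA hc
    have h2 := hA ha
    have h3 := hB hb
    simp only [Set.mem_insert_iff, Set.mem_singleton_iff] at *
    grind
  have hB' : B ⊆ {b} := by
    intro c hc
    by_contra hcb
    have h1 := hB hc
    have h2 := hA ha
    have h3 := hB hb
    simp only [Set.mem_insert_iff, Set.mem_singleton_iff] at *
    grind
  rintro v ⟨hv, hv'⟩
  have hva := convexHull_mono hA' hv
  have hvb := convexHull_mono hB' hv'
  simp only [convexHull_singleton, Set.mem_singleton_iff] at hva hvb
  exact absurd (hva.symm.trans hvb) hab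

theorem pyramid_row_bounds {ε α : ℤ} {x : ℤ → ℤ} {q a b : ℤ} {t : ℤ × ℤ × ℤ}
    (ht : IsChordTriangle (fun k => ε * x k) q a b t) {v : Fin 3 → ℝ}
    (hv : v ∈ convexHull ℝ (pyramid α x q t)) :
    row q t.1 * v 2 ≤ v 1 ∧ v 1 ≤ row q t.2.2 * v 2 ∧ v 2 ≤ 1 := by
  obtain ⟨-, h2, h3, -, -, -, -⟩ := ht
  have c1 : row q t.1 ≤ row q t.2.1 := by unfold row; omega
  have c2 : row q t.2.1 ≤ row q t.2.2 := by unfold row; omega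
  have c3 := c1.trans c2
  have b1 := ((rowForm_preservesAffine (row q t.1 : ℝ)).neg.mem_face (A := pyramid α x q t)
    (by rintro v (rfl | rfl | rfl | rfl) <;> simp [basePt, topPt, c1, c3]) hv).1
  have b2 := ((rowForm_preservesAffine (row q t.2.2 : ℝ)).mem_face (A := pyramid α x q t)
    (by rintro v (rfl | rfl | rfl | rfl) <;> simp [basePt, topPt, c2, c3]) hv).1
  have b3 := (heightForm_preservesAffine.mem_face (A := pyramid α x q t)
    (by rintro v (rfl | rfl | rfl | rfl) <;> simp [basePt, topPt]) hv).1
  exact ⟨by linarith, by linarith, by linarith⟩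

/-- Pyramids on the two sides of the lattice path meet in a common face. -/
theorem left_pyramid_meets_right_pyramid {x : ℤ → ℤ} {q : ℤ} {t t' : ℤ × ℤ × ℤ}
    (ht : IsChordTriangle (fun k => (-1) * x k) q 0 q t)
    (ht' : IsChordTriangle (fun k => 1 * x k) q (-1) (q + 1) t') :
    MeetsInFace (pyramid 0 x q t) (pyramid 2 x q t') := by
  have hl : IsSide (-1) 0 := .inl ⟨rfl, rfl⟩
  have hr : IsSide 1 2 := .inr ⟨rfl, rfl⟩
  obtain ⟨h1, h2, h3, h4, -, -, -⟩ := id ht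
  obtain ⟨h1', h2', h3', h4', -, -, -⟩ := id ht'
  rcases le_or_gt t.2.2 t'.1 with h | hji'
  · refine pyramid_meets_after hl (by norm_num) ht (by omega) ?_
    rintro v (rfl | rfl | rfl | rfl)
    · exact .inl ⟨2, by omega, by omega, rfl⟩
    · exact .inr ⟨_, by omega, rfl⟩
    · exact .inr ⟨_, by omega, rfl⟩
    · exact .inr ⟨_, by omega, rfl⟩
  rcases le_or_gt t'.2.2 t.1 with h | hj'i
  · refine pyramid_meets_before hl (by omega) ht (by omega) ?_
    rintro v (rfl | rfl | rfl | rfl)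
    · exact .inl ⟨2, by omega, by omega, rfl⟩
    · exact .inr ⟨_, by omega, rfl⟩
    · exact .inr ⟨_, by omega, rfl⟩
    · exact .inr ⟨_, by omega, rfl⟩
  rintro v ⟨hv, hv'⟩
  obtain ⟨b1, b2, b3⟩ := pyramid_row_bounds ht hv
  obtain ⟨b1', b2', -⟩ := pyramid_row_bounds ht' hv'
  obtain ⟨k, hk1, hk2, hk3, hk4⟩ : ∃ k : ℤ, max t.1 t'.1 ≤ k ∧ k < min t.2.2 t'.2.2 ∧
      k * v 2 ≤ v 1 ∧ v 1 ≤ (k + 1) * v 2 := by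
    refine exists_strip (by omega) ?_ ?_
    · rcases max_cases t.1 t'.1 with ⟨h, -⟩ | ⟨h, h'⟩ <;> rw [h]
      · rwa [show row q t.1 = t.1 by unfold row; omega] at b1
      · rwa [show row q t'.1 = t'.1 by unfold row; omega] at b1'
    · rcases min_cases t.2.2 t'.2.2 with ⟨h, -⟩ | ⟨h, h'⟩ <;> rw [h]
      · rwa [show row q t.2.2 = t.2.2 by unfold row; omega] at b2
      · rwa [show row q t'.2.2 = t'.2.2 by unfold row; omega] at b2'
  have hk0 : 0 ≤ k := by omega
  have hkq : k < q := by omega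
  have r0 : row q k = k := by unfold row; omega
  have r1 : row q (k + 1) = k + 1 := by unfold row; omega
  have hle := sideForm_path_nonpos ht hk0 hkq (by omega) (by omega) hv hk3 hk4
  have hle' := sideForm_path_nonpos ht' hk0 hkq (by omega) (by omega) hv' hk3 hk4
  simp only [sideForm, chordForm, sideCoord, r0, r1] at hle hle'
  push_cast at hle hle'
  have hz : v 2 = 1 := by linarith
  rw [hz] at hle hle' hk3 hk4
  have hx : v 0 = x k + (x (k + 1) - x k) * (v 1 - k) := by linarith
  have hmem : v ∈ convexHull ℝ ({topPt x q k, topPt x q (k + 1)} : Set (Fin 3 → ℝ)) := by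
    rw [convexHull_pair]
    refine ⟨k + 1 - v 1, v 1 - k, by linarith, by linarith, by ring, ?_⟩
    ext i
    fin_cases i
    · simp [topPt, hx]; ring
    · simp [topPt, r0, r1]; ring
    · simp [topPt, hz]
  have hface : ∀ (A : Set (Fin 3 → ℝ)) (e : ℤ), MeetsInFace A (pathJoin x q e k) →
      v ∈ convexHull ℝ A →
      v ∈ convexHull ℝ (A ∩ {topPt x q k, topPt x q (k + 1)}) := by
    intro A e hA hvA
    have hvM : v ∈ convexHull ℝ (pathJoin x q e k) :=
      convexHull_mono (by rintro w (rfl | rfl) <;> simp [pathJoin]) hmem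
    have h := (heightForm_preservesAffine.mem_face (A := A ∩ pathJoin x q e k)
      (by rintro v ⟨-, rfl | rfl | rfl | rfl⟩ <;> simp [basePt, topPt]) (hA ⟨hvA, hvM⟩)).2
      (by rw [hz, sub_self])
    refine convexHull_mono ?_ h
    rintro w ⟨⟨hwA, hw⟩, hw2⟩
    refine ⟨hwA, ?_⟩
    rcases hw with rfl | rfl | rfl | rfl
    · simp [basePt] at hw2
    · simp [basePt] at hw2
    · simp
    · simp
  have e1 := hface _ 0 (pyramid_meets_pathJoin hl (by norm_num) (by omega) ht le_rfl zero_le_one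
    hk0 hkq) hv
  have e2 := hface _ 1 (pyramid_meets_pathJoin hr (by norm_num) (by omega) ht' zero_le_one le_rfl
    hk0 hkq) hv'
  refine convexHull_mono ?_ (MeetsInFace.of_subset_pair Set.inter_subset_right
    Set.inter_subset_right ⟨e1, e2⟩)
  exact Set.inter_subset_inter Set.inter_subset_left Set.inter_subset_left

/-! ### Half-unimodular simplices from integral ones -/

/-- The affine map `x ↦ A·x + b`. -/
noncomputable def integralAffine (A : Matrix (Fin 3) (Fin 3) ℤ) (b : Fin 3 → ℤ) :
    (Fin 3 → ℝ) →ᵃ[ℝ] (Fin 3 → ℝ) :=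
  (A.map (Int.cast : ℤ → ℝ)).mulVecLin.toAffineMap + AffineMap.const ℝ _ fun i => (b i : ℝ)

theorem integralAffine_apply (A : Matrix (Fin 3) (Fin 3) ℤ) (b : Fin 3 → ℤ) (v : Fin 3 → ℝ) :
    integralAffine A b v = (A.map (Int.cast : ℤ → ℝ)).mulVec v + fun i => (b i : ℝ) := rfl

theorem det_map_intCast_ne_zero {A : Matrix (Fin 3) (Fin 3) ℤ} (hA : IsUnit A.det) :
    (A.map (Int.cast : ℤ → ℝ)).det ≠ 0 := by
  have h : (A.map (Int.cast : ℤ → ℝ)).det = (A.det : ℝ) := (Int.cast_det A).symm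
  rw [h]
  exact_mod_cast hA.ne_zero

theorem integralAffine_injective {A : Matrix (Fin 3) (Fin 3) ℤ} (hA : IsUnit A.det)
    (b : Fin 3 → ℤ) : Function.Injective (integralAffine A b) := by
  intro v w h
  simp only [integralAffine_apply, add_left_inj] at h
  refine sub_eq_zero.1 (Matrix.eq_zero_of_mulVec_eq_zero (det_map_intCast_ne_zero hA) ?_)
  rw [Matrix.mulVec_sub, h, sub_self]

/-- The matrix whose columns are the edge vectors of a simplex at its first vertex. -/
def edgeMatrix (W : Fin 4 → Fin 3 → ℤ) : Matrix (Fin 3) (Fin 3) ℤ :=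
  Matrix.of fun i j => W j.succ i - W 0 i

/-- The set `A` consists of the vertices of a unimodular simplex, one of which is even. -/
def IsUnimodularCell (A : Set (Fin 3 → ℝ)) : Prop :=
  ∃ W : Fin 4 → Fin 3 → ℤ, Set.range (fun j i => (W j i : ℝ)) = A ∧
    IsUnit (edgeMatrix W).det ∧ ∃ j, ∀ i, Even (W j i)

theorem image_baseSimplex (W : Fin 4 → Fin 3 → ℤ) :
    integralAffine (edgeMatrix W) (W 0) '' baseSimplex 3 3 =
      convexHull ℝ (Set.range fun j i => (W j i : ℝ)) := by
  have hs : ∀ j : Fin 3, integralAffine (edgeMatrix W) (W 0) (Pi.single j 1) =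
      fun i => (W j.succ i : ℝ) := by
    intro j
    ext i
    simp [integralAffine_apply, edgeMatrix]
  have h0 : integralAffine (edgeMatrix W) (W 0) 0 = fun i => (W 0 i : ℝ) := by
    simp [integralAffine_apply]
  have hset : {j : Fin 3 | (j : ℕ) < 3} = Set.univ := by
    ext j
    simp
  rw [baseSimplex, AffineMap.image_convexHull, Set.image_insert_eq, h0, hset, Set.image_univ,
    ← Set.range_comp]
  congr 1
  ext v
  simp [Fin.exists_fin_succ, hs, eq_comm]

theorem affineIndependent_half {W : Fin 4 → Fin 3 → ℤ} (hW : IsUnit (edgeMatrix W).det) :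
    AffineIndependent ℝ fun j i => (W j i : ℝ) / 2 := by
  rw [affineIndependent_iff_of_fintype]
  intro w hw h
  rw [Finset.weightedVSub_eq_linear_combination _ hw] at h
  have hker : ((edgeMatrix W).map (Int.cast : ℤ → ℝ)).mulVec (fun j => w j.succ) = 0 := by
    ext i
    have hi := congrFun h i
    simp only [Fin.sum_univ_succ, Finset.sum_apply, Pi.smul_apply, smul_eq_mul, Pi.zero_apply,
      Matrix.mulVec, dotProduct, edgeMatrix, Matrix.map_apply, Matrix.of_apply, Int.cast_sub,
      Finset.univ_eq_empty, Finset.sum_empty] at hi hw ⊢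
    linear_combination 2 * hi - (W 0 i : ℝ) * hw
  have hz := Matrix.eq_zero_of_mulVec_eq_zero (det_map_intCast_ne_zero hW) hker
  have hs : ∀ j : Fin 3, w j.succ = 0 := congrFun hz
  intro j
  refine Fin.cases ?_ hs j
  simpa [Fin.sum_univ_succ, hs] using hw

theorem HasGoodHalfUnimodularTriangulation.of_finite {S : Set (Fin 3 → ℝ)}
    {K : Set (Set (Fin 3 → ℝ))} (hfin : K.Finite) (hcell : ∀ A ∈ K, IsUnimodularCell A)
    (hS : (2 : ℝ) • S = ⋃ A ∈ K, convexHull ℝ A)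
    (hmeet : ∀ A ∈ K, ∀ B ∈ K, MeetsInFace A B) : HasGoodHalfUnimodularTriangulation S := by
  have : Finite K := hfin
  obtain ⟨r, ⟨e⟩⟩ := Finite.exists_equiv_fin K
  choose W hW hdet heven using fun t => hcell (e.symm t).1 (e.symm t).2
  have hrange : ∀ t, Set.range (fun (j : Fin 4) (i : Fin 3) => (W t j i : ℝ) / 2) =
      (2 : ℝ)⁻¹ • (e.symm t).1 := by
    intro t
    rw [← hW t, ← Set.image_smul, ← Set.range_comp]
    congr 1
    ext j i
    simp [div_eq_inv_mul]
  refine ⟨r, fun t j i => (W t j i : ℝ) / 2, fun t => affineIndependent_half (hdet t), ?_, ?_, ?_,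
    ?_⟩
  · intro t
    refine ⟨_, ⟨_, hdet t, _, integralAffine_apply _ (W t 0)⟩, ?_⟩
    rw [image_baseSimplex, hrange, hW, convexHull_smul, smul_inv_smul₀ two_ne_zero]
  · intro t
    obtain ⟨j, hj⟩ := heven t
    refine ⟨j, fun i => ?_⟩
    obtain ⟨m, hm⟩ := hj i
    refine ⟨m, ?_⟩
    simp only [hm]
    push_cast
    ring
  · rw [← inv_smul_smul₀ (two_ne_zero (α := ℝ)) S, hS]
    simp only [hrange, convexHull_smul, Set.smul_set_iUnion]
    rw [Set.biUnion_eq_iUnion]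
    exact (e.symm.surjective.iUnion_comp fun A : K => (2 : ℝ)⁻¹ • convexHull ℝ A.1).symm
  · intro t s
    refine ⟨(2 : ℝ)⁻¹ • ((e.symm t).1 ∩ (e.symm s).1), ?_, ?_, ?_⟩
    · rw [hrange]
      exact Set.smul_set_mono Set.inter_subset_left
    · rw [hrange]
      exact Set.smul_set_mono Set.inter_subset_right
    · rw [hrange, hrange]
      simp only [convexHull_smul]
      rw [← Set.smul_set_inter₀ (by norm_num)]
      congr 1
      refine Set.Subset.antisymm (hmeet _ (e.symm t).2 _ (e.symm s).2) ?_
      exact Set.subset_inter (convexHull_mono Set.inter_subset_left)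
        (convexHull_mono Set.inter_subset_right)

theorem HasGoodHalfUnimodularTriangulation.image {S : Set (Fin 3 → ℝ)}
    (hS : HasGoodHalfUnimodularTriangulation S) {A : Matrix (Fin 3) (Fin 3) ℤ}
    (hA : IsUnit A.det) (b : Fin 3 → ℤ) :
    HasGoodHalfUnimodularTriangulation (integralAffine A b '' S) := by
  obtain ⟨r, V, hind, hhalf, hint, rfl, hmeet⟩ := hS
  have hinj := integralAffine_injective hA b
  have hhull : ∀ B, convexHull ℝ (integralAffine A b '' B) = integralAffine A b '' convexHull ℝ B :=
    fun B => (AffineMap.image_convexHull _ B).symm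
  refine ⟨r, fun t => integralAffine A b ∘ V t, fun t => (hind t).map' _ hinj, ?_, ?_, ?_, ?_⟩
  · intro t
    obtain ⟨f, ⟨A₀, hA₀, b₀, hf⟩, hV⟩ := hhalf t
    refine ⟨_, ⟨A * A₀, by rw [Matrix.det_mul]; exact hA.mul hA₀, A.mulVec b₀ + 2 • b,
      integralAffine_apply _ _⟩, ?_⟩
    have h1 : (2 : ℝ) • integralAffine A b '' convexHull ℝ (Set.range (V t)) =
        integralAffine A (2 • b) '' ((2 : ℝ) • convexHull ℝ (Set.range (V t))) := by
      rw [← Set.image_smul, ← Set.image_smul, Set.image_image, Set.image_image]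
      refine Set.image_congr fun v _ => ?_
      ext i
      simp [integralAffine_apply, Matrix.mulVec_smul, mul_add]
    rw [Set.range_comp, hhull, h1, hV, Set.image_image]
    refine Set.image_congr fun v _ => ?_
    rw [hf]
    ext i
    simp [integralAffine_apply, Matrix.mulVec_add, Matrix.mulVec_mulVec, Matrix.mulVec,
      dotProduct, Matrix.mul_apply, Fin.sum_univ_three]
    ring
  · intro t
    obtain ⟨j, hj⟩ := hint t
    choose m hm using hj
    refine ⟨j, fun i => ⟨(A.mulVec m + b) i, ?_⟩⟩
    simp [integralAffine_apply, Matrix.mulVec, dotProduct, hm]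
  · simp only [Set.image_iUnion, Set.range_comp, hhull]
  · intro t s
    obtain ⟨W, hWt, hWs, hW⟩ := hmeet t s
    refine ⟨integralAffine A b '' W, ?_, ?_, ?_⟩
    · rw [Set.range_comp]
      exact Set.image_mono hWt
    · rw [Set.range_comp]
      exact Set.image_mono hWs
    · rw [Set.range_comp, Set.range_comp, hhull, hhull, hhull, ← Set.image_inter hinj, hW]

/-! ### The lattice path and the cells of the lower half -/

theorem cast_vec (a b c : ℤ) : (fun i => ((![a, b, c] i : ℤ) : ℝ)) = ![(a : ℝ), b, c] := by
  ext i
  fin_cases i <;> rfl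

theorem range_cast (a b c d : Fin 3 → ℤ) :
    Set.range (fun j i => ((![a, b, c, d] j i : ℤ) : ℝ)) =
      {fun i => (a i : ℝ), fun i => (b i : ℝ), fun i => (c i : ℝ), fun i => (d i : ℝ)} := by
  ext v
  simp only [Set.mem_range, Fin.exists_fin_succ, Set.mem_insert_iff, Set.mem_singleton_iff]
  simp [eq_comm]

theorem isUnimodularCell_pathJoin (x : ℤ → ℤ) {q e k : ℤ} (he : 0 ≤ e) (he₁ : e ≤ 1) (hk : 0 ≤ k)
    (hkq : k < q) : IsUnimodularCell (pathJoin x q e k) := by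
  have r0 : row q k = k := by unfold row; omega
  have r1 : row q (k + 1) = k + 1 := by unfold row; omega
  refine ⟨![![e, 0, 0], ![e + 1, 0, 0], ![x k, row q k, 1], ![x (k + 1), row q (k + 1), 1]],
    ?_, ?_, ?_⟩
  · rw [range_cast]
    simp only [cast_vec]
    simp [pathJoin, basePt, topPt]
  · simp [edgeMatrix, Matrix.det_fin_three, r0, r1]
  · obtain rfl | rfl : e = 0 ∨ e = 1 := by omega
    · exact ⟨0, fun i => by fin_cases i <;> simp⟩
    · exact ⟨1, fun i => by fin_cases i <;> simp⟩

theorem isUnimodularCell_pyramid {ε α : ℤ} {x : ℤ → ℤ} {q a b : ℤ} {t : ℤ × ℤ × ℤ}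
    (hs : IsSide ε α) (ht : IsChordTriangle (fun k => ε * x k) q a b t) :
    IsUnimodularCell (pyramid α x q t) := by
  have h := ht.orient_eq
  refine ⟨![![α, 0, 0], ![x t.1, row q t.1, 1], ![x t.2.1, row q t.2.1, 1],
    ![x t.2.2, row q t.2.2, 1]], ?_, ?_, ?_⟩
  · rw [range_cast]
    simp only [cast_vec]
    simp [pyramid, basePt, topPt]
  · rw [Int.isUnit_iff]
    simp only [edgeMatrix, Matrix.det_fin_three, orient] at h ⊢
    rcases hs with ⟨rfl, rfl⟩ | ⟨rfl, rfl⟩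
    · left
      simp
      linear_combination h
    · right
      simp
      linear_combination -h
  · refine ⟨0, fun i => ?_⟩
    rcases hs with ⟨rfl, rfl⟩ | ⟨rfl, rfl⟩ <;> fin_cases i <;> simp

theorem mem_pyramid_of_sideForm {ε α : ℤ} {x : ℤ → ℤ} {q a b : ℤ} {t : ℤ × ℤ × ℤ}
    (hs : IsSide ε α) (ht : IsChordTriangle (fun k => ε * x k) q a b t) {v : Fin 3 → ℝ}
    (hz : v 2 ≤ 1) (h1 : 0 ≤ sideForm ε α x q t.1 t.2.2 v)
    (h2 : sideForm ε α x q t.1 t.2.1 v ≤ 0) (h3 : sideForm ε α x q t.2.1 t.2.2 v ≤ 0) :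
    v ∈ convexHull ℝ (pyramid α x q t) := by
  have h : ((orient (fun k => ε * x k) q t.1 t.2.1 t.2.2 : ℤ) : ℝ) = 1 := by
    exact_mod_cast ht.orient_eq
  refine mem_convexHull_four (1 - v 2) (-sideForm ε α x q t.2.1 t.2.2 v)
    (sideForm ε α x q t.1 t.2.2 v) (-sideForm ε α x q t.1 t.2.1 v) (by linarith) (by linarith) h1
    (by linarith) ?_ ?_
  · simp only [sideForm, chordForm, orient] at h ⊢
    push_cast at h ⊢
    linear_combination v 2 * h
  · simp only [sideForm, chordForm, orient, sideCoord] at h ⊢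
    push_cast at h ⊢
    intro i
    rcases hs with ⟨rfl, rfl⟩ | ⟨rfl, rfl⟩ <;> fin_cases i
    · simp [basePt, topPt] at h ⊢
      linear_combination -v 0 * h
    · simp [basePt, topPt] at h ⊢
      linear_combination -v 1 * h
    · simp [basePt, topPt] at h ⊢
      linear_combination -v 2 * h
    · simp [basePt, topPt] at h ⊢
      linear_combination -(v 0 - 2 * (1 - v 2)) * h
    · simp [basePt, topPt] at h ⊢
      linear_combination -v 1 * h
    · simp [basePt, topPt] at h ⊢
      linear_combination -v 2 * h

/-- Twice the lower half of `T(p, q)`. -/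
def doubledHalf (p q : ℤ) : Set (Fin 3 → ℝ) :=
  {v | 0 ≤ v 2 ∧ v 2 ≤ 1 ∧ 0 ≤ v 1 ∧ v 1 ≤ q * v 2 ∧ 0 ≤ q * v 0 - p * v 1 ∧
    q * v 0 - p * v 1 ≤ q * (2 - v 2)}

theorem convex_doubledHalf (p q : ℤ) : Convex ℝ (doubledHalf p q) := by
  rintro v ⟨h1, h2, h3, h4, h5, h6⟩ w ⟨h1', h2', h3', h4', h5', h6'⟩ s t hs ht hst
  obtain rfl : t = 1 - s := by linarith
  simp only [doubledHalf, Set.mem_ofPred_eq, Pi.add_apply, Pi.smul_apply, smul_eq_mul]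
  refine ⟨?_, ?_, ?_, ?_, ?_, ?_⟩
  · linarith [mul_nonneg hs h1, mul_nonneg ht h1']
  · linarith [mul_nonneg hs (sub_nonneg.2 h2), mul_nonneg ht (sub_nonneg.2 h2')]
  · linarith [mul_nonneg hs h3, mul_nonneg ht h3']
  · linarith [mul_nonneg hs (sub_nonneg.2 h4), mul_nonneg ht (sub_nonneg.2 h4')]
  · linarith [mul_nonneg hs h5, mul_nonneg ht h5']
  · linarith [mul_nonneg ht (sub_nonneg.2 h6'), mul_nonneg hs (sub_nonneg.2 h6)]

/-- The lattice path along the edge of direction `(p, q)`. For `0 ≤ k ≤ q` this is the leftmost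
lattice point of row `k` in the upper facet of the doubled half; the indices `-1` and `q + 1` stand
for the far endpoints of its bottom and top edges. -/
def pathPos (p q k : ℤ) : ℤ :=
  if k < 0 then 1 else if q < k then p + 1 else -(-(k * p) / q)

section Path

variable {p q : ℤ}

theorem pathPos_excess {k : ℤ} (hk : 0 ≤ k) (hkq : k ≤ q) :
    q * pathPos p q k - p * k = -(k * p) % q := by
  have := Int.emod_add_mul_ediv (-(k * p)) q
  rw [pathPos, if_neg (by omega), if_neg (by omega)]
  linear_combination -this

theorem pathPos_excess_nonneg (hq : 1 ≤ q) {k : ℤ} (hk : 0 ≤ k) (hkq : k ≤ q) :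
    0 ≤ q * pathPos p q k - p * k := by
  rw [pathPos_excess hk hkq]
  exact Int.emod_nonneg _ (by omega)

theorem pathPos_excess_lt (hq : 1 ≤ q) {k : ℤ} (hk : 0 ≤ k) (hkq : k ≤ q) :
    q * pathPos p q k - p * k < q := by
  rw [pathPos_excess hk hkq]
  exact Int.emod_lt_of_pos _ (by omega)

theorem pathPos_excess_pos (hq : 1 ≤ q) (hpq : IsCoprime p q) {k : ℤ} (hk : 0 < k) (hkq : k < q) :
    0 < q * pathPos p q k - p * k := by
  refine lt_of_le_of_ne (pathPos_excess_nonneg hq hk.le hkq.le) fun h => ?_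
  have h1 : q ∣ p * k := ⟨pathPos p q k, by linarith⟩
  have h2 := Int.le_of_dvd hk (hpq.symm.dvd_of_dvd_mul_left h1)
  omega

theorem pathPos_zero (hq : 1 ≤ q) : pathPos p q 0 = 0 := by
  rw [pathPos, if_neg (by omega), if_neg (by omega)]
  simp

theorem pathPos_self (hq : 1 ≤ q) : pathPos p q q = p := by
  rw [pathPos, if_neg (by omega), if_neg (by omega), ← mul_neg,
    Int.mul_ediv_cancel_left _ (by omega), neg_neg]

theorem pathPos_neg_one (p q : ℤ) : pathPos p q (-1) = 1 := by
  simp [pathPos]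

theorem pathPos_succ_self (hq : 1 ≤ q) : pathPos p q (q + 1) = p + 1 := by
  rw [pathPos, if_neg (by omega), if_pos (by omega)]

theorem basePt_mem_doubledHalf (hq : 1 ≤ q) {e : ℤ} (he : 0 ≤ e) (he' : e ≤ 2) :
    basePt e ∈ doubledHalf p q := by
  have h0 : (0 : ℝ) ≤ q := by exact_mod_cast (by omega : 0 ≤ q)
  have h1 : (0 : ℝ) ≤ e := by exact_mod_cast he
  have h2 : (e : ℝ) ≤ 2 := by exact_mod_cast he'
  simp [doubledHalf, basePt]
  exact ⟨by positivity, by gcongr⟩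

theorem topPt_mem_doubledHalf (hq : 1 ≤ q) {k : ℤ} (hk : -1 ≤ k) (hkq : k ≤ q + 1) :
    topPt (pathPos p q) q k ∈ doubledHalf p q := by
  have h0 : 0 ≤ row q k := by unfold row; omega
  have h1 : row q k ≤ q := by unfold row; omega
  have h2 : 0 ≤ q * pathPos p q k - p * row q k ∧ q * pathPos p q k - p * row q k ≤ q := by
    obtain rfl | rfl | ⟨hk0, hkq'⟩ : k = -1 ∨ k = q + 1 ∨ 0 ≤ k ∧ k ≤ q := by omega
    · rw [pathPos_neg_one, show row q (-1) = 0 by unfold row; omega]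
      omega
    · rw [pathPos_succ_self hq, show row q (q + 1) = q by unfold row; omega]
      constructor <;> linarith
    · rw [show row q k = k by unfold row; omega]
      exact ⟨pathPos_excess_nonneg hq hk0 hkq', (pathPos_excess_lt hq hk0 hkq').le⟩
  have h3 : (0 : ℝ) ≤ row q k := by exact_mod_cast h0
  have h4 : (row q k : ℝ) ≤ q := by exact_mod_cast h1
  have h5 : (0 : ℝ) ≤ q * pathPos p q k - p * row q k := by exact_mod_cast h2.1
  have h6 : (q : ℝ) * pathPos p q k - p * row q k ≤ q := by exact_mod_cast h2.2
  simp only [doubledHalf, topPt, Set.mem_ofPred_eq, Matrix.cons_val]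
  exact ⟨zero_le_one, le_rfl, h3, by linarith, h5, by linarith⟩

theorem exists_leftTriangulation (hq : 1 ≤ q) (hpq : IsCoprime p q) :
    ∃ F : Finset (ℤ × ℤ × ℤ),
      (∀ t ∈ F, IsChordTriangle (fun k => (-1) * pathPos p q k) q 0 q t) ∧
      (∀ t ∈ F, ∀ t' ∈ F, t = t' ∨ Precedes t t' ∨ Precedes t' t) ∧
      ∀ k v, 0 ≤ k → k < q → v ∈ doubledHalf p q → k * v 2 ≤ v 1 → v 1 ≤ (k + 1) * v 2 →
        sideForm (-1) 0 (pathPos p q) q k (k + 1) v < 0 →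
        ∃ t ∈ F, v ∈ convexHull ℝ (pyramid 0 (pathPos p q) q t) := by
  have r0 : row q 0 = 0 := by unfold row; omega
  have r1 : row q q = q := by unfold row; omega
  have hcop : IsCoprime ((-1) * pathPos p q q - (-1) * pathPos p q 0) (row q q - row q 0) := by
    rw [pathPos_zero hq, pathPos_self hq, r0, r1]
    simpa using hpq.neg_left
  have hor : ∀ s, 0 < s → s < q → 1 ≤ orient (fun k => (-1) * pathPos p q k) q 0 s q ∧
      orient (fun k => (-1) * pathPos p q k) q 0 s q ≤ row q q - row q 0 := by
    intro s hs hsq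
    have h1 := pathPos_excess_pos hq hpq hs hsq
    have h2 := pathPos_excess_lt (p := p) hq hs.le hsq.le
    have hid : orient (fun k => (-1) * pathPos p q k) q 0 s q = q * pathPos p q s - p * s := by
      rw [orient, pathPos_zero hq, pathPos_self hq, r0, r1, show row q s = s by unfold row; omega]
      ring
    rw [hid, r0, r1]
    omega
  obtain ⟨F, hF, hL, hC⟩ := exists_chordTriangulation hq 0 q (by omega) (by omega) (by omega)
    hcop hor
  refine ⟨F, hF, hL, fun k v hk hkq hv h1 h2 h3 => ?_⟩
  obtain ⟨-, hz, -, -, h4, -⟩ := hv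
  have hroot : 0 ≤ chordForm (fun k => (-1) * pathPos p q k) q 0 q (sideCoord (-1) 0 v) (v 1)
      (v 2) := by
    simp only [chordForm, sideCoord, pathPos_zero hq, pathPos_self hq, r0, r1]
    push_cast
    linarith
  obtain ⟨t, ht, h5, h6, h7⟩ := hC k _ _ _ hk hkq hk hkq h1 h2 hroot h3
  exact ⟨t, ht, mem_pyramid_of_sideForm (.inl ⟨rfl, rfl⟩) (hF t ht) hz h5 h6 h7⟩

theorem exists_rightTriangulation (hq : 1 ≤ q) (hpq : IsCoprime p q) :
    ∃ F : Finset (ℤ × ℤ × ℤ),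
      (∀ t ∈ F, IsChordTriangle (fun k => 1 * pathPos p q k) q (-1) (q + 1) t) ∧
      (∀ t ∈ F, ∀ t' ∈ F, t = t' ∨ Precedes t t' ∨ Precedes t' t) ∧
      ∀ k v, 0 ≤ k → k < q → v ∈ doubledHalf p q → k * v 2 ≤ v 1 → v 1 ≤ (k + 1) * v 2 →
        sideForm 1 2 (pathPos p q) q k (k + 1) v < 0 →
        ∃ t ∈ F, v ∈ convexHull ℝ (pyramid 2 (pathPos p q) q t) := by
  have r0 : row q (-1) = 0 := by unfold row; omega
  have r1 : row q (q + 1) = q := by unfold row; omega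
  have hcop : IsCoprime (1 * pathPos p q (q + 1) - 1 * pathPos p q (-1))
      (row q (q + 1) - row q (-1)) := by
    rw [pathPos_neg_one, pathPos_succ_self hq, r0, r1]
    simpa using hpq
  have hor : ∀ s, -1 < s → s < q + 1 →
      1 ≤ orient (fun k => 1 * pathPos p q k) q (-1) s (q + 1) ∧
      orient (fun k => 1 * pathPos p q k) q (-1) s (q + 1) ≤ row q (q + 1) - row q (-1) := by
    intro s hs hsq
    have h1 := pathPos_excess_nonneg (p := p) hq (k := s) (by omega) (by omega)
    have h2 := pathPos_excess_lt (p := p) hq (k := s) (by omega) (by omega)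
    have hid : orient (fun k => 1 * pathPos p q k) q (-1) s (q + 1) =
        q - (q * pathPos p q s - p * s) := by
      rw [orient, pathPos_neg_one, pathPos_succ_self hq, r0, r1,
        show row q s = s by unfold row; omega]
      ring
    rw [hid, r0, r1]
    omega
  obtain ⟨F, hF, hL, hC⟩ := exists_chordTriangulation hq (-1) (q + 1) (by omega) (by omega)
    (by omega) hcop hor
  refine ⟨F, hF, hL, fun k v hk hkq hv h1 h2 h3 => ?_⟩
  obtain ⟨-, hz, -, -, -, h4⟩ := hv
  have hroot : 0 ≤ chordForm (fun k => 1 * pathPos p q k) q (-1) (q + 1) (sideCoord 1 2 v) (v 1)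
      (v 2) := by
    simp only [chordForm, sideCoord, pathPos_neg_one, pathPos_succ_self hq, r0, r1]
    push_cast
    linarith
  obtain ⟨t, ht, h5, h6, h7⟩ := hC k _ _ _ (by omega) (by omega) hk hkq h1 h2 hroot h3
  exact ⟨t, ht, mem_pyramid_of_sideForm (.inr ⟨rfl, rfl⟩) (hF t ht) hz h5 h6 h7⟩

theorem mem_pathJoin_zero {x : ℤ → ℤ} {k : ℤ} (hk : 0 ≤ k) (hkq : k < q) {v : Fin 3 → ℝ}
    (h1 : k * v 2 ≤ v 1) (h2 : v 1 ≤ (k + 1) * v 2)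
    (h3 : 0 ≤ sideForm (-1) 0 x q k (k + 1) v) (h4 : 0 ≤ sideForm 1 1 x q k (k + 1) v) :
    v ∈ convexHull ℝ (pathJoin x q 0 k) := by
  have r0 : row q k = k := by unfold row; omega
  have r1 : row q (k + 1) = k + 1 := by unfold row; omega
  refine mem_convexHull_four _ _ ((k + 1) * v 2 - v 1) (v 1 - k * v 2) h4 h3 (by linarith)
    (by linarith) ?_ fun i => ?_
  · simp only [sideForm, chordForm, sideCoord, r0, r1]
    push_cast
    ring
  · fin_cases i <;> simp [sideForm, chordForm, sideCoord, r0, r1, basePt, topPt] <;> ring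

theorem mem_pathJoin_one {x : ℤ → ℤ} {k : ℤ} (hk : 0 ≤ k) (hkq : k < q) {v : Fin 3 → ℝ}
    (h1 : k * v 2 ≤ v 1) (h2 : v 1 ≤ (k + 1) * v 2)
    (h3 : 0 ≤ -sideForm 1 1 x q k (k + 1) v) (h4 : 0 ≤ sideForm 1 2 x q k (k + 1) v) :
    v ∈ convexHull ℝ (pathJoin x q 1 k) := by
  have r0 : row q k = k := by unfold row; omega
  have r1 : row q (k + 1) = k + 1 := by unfold row; omega
  refine mem_convexHull_four _ _ ((k + 1) * v 2 - v 1) (v 1 - k * v 2) h4 h3 (by linarith)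
    (by linarith) ?_ fun i => ?_
  · simp only [sideForm, chordForm, sideCoord, r0, r1]
    push_cast
    ring
  · fin_cases i <;> simp [sideForm, chordForm, sideCoord, r0, r1, basePt, topPt] <;> ring

end Path

/-- The cells of the triangulation of the doubled half. -/
def cells (p q : ℤ) (F F' : Finset (ℤ × ℤ × ℤ)) : Set (Set (Fin 3 → ℝ)) :=
  pathJoin (pathPos p q) q 0 '' Set.Ico 0 q ∪ pathJoin (pathPos p q) q 1 '' Set.Ico 0 q ∪
    pyramid 0 (pathPos p q) q '' F ∪ pyramid 2 (pathPos p q) q '' F'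

theorem hasGood_half_doubledHalf {p q : ℤ} (hq : 1 ≤ q) (hpq : IsCoprime p q) :
    HasGoodHalfUnimodularTriangulation ((2 : ℝ)⁻¹ • doubledHalf p q) := by
  obtain ⟨F, hF, hL, hC⟩ := exists_leftTriangulation hq hpq
  obtain ⟨F', hF', hL', hC'⟩ := exists_rightTriangulation hq hpq
  have hl : IsSide (-1) 0 := .inl ⟨rfl, rfl⟩
  have hr : IsSide 1 2 := .inr ⟨rfl, rfl⟩
  refine .of_finite (K := cells p q F F') ?_ ?_ ?_ ?_
  · exact ((((Set.finite_Ico 0 q).image _).union ((Set.finite_Ico 0 q).image _)).union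
      (F.finite_toSet.image _)).union (F'.finite_toSet.image _)
  · rintro A (((⟨k, ⟨hk, hkq⟩, rfl⟩ | ⟨k, ⟨hk, hkq⟩, rfl⟩) | ⟨t, ht, rfl⟩) | ⟨t, ht, rfl⟩)
    · exact isUnimodularCell_pathJoin _ le_rfl zero_le_one hk hkq
    · exact isUnimodularCell_pathJoin _ zero_le_one le_rfl hk hkq
    · exact isUnimodularCell_pyramid hl (hF t ht)
    · exact isUnimodularCell_pyramid hr (hF' t ht)
  · rw [smul_inv_smul₀ two_ne_zero]
    refine Set.Subset.antisymm (fun v hv => ?_) (Set.iUnion₂_subset fun A hA => ?_)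
    · rw [Set.mem_iUnion₂]
      obtain ⟨-, hz, h1, h2, -, -⟩ := id hv
      obtain ⟨k, hk, hkq, h3, h4⟩ :=
        exists_strip (a := 0) (b := q) (by omega) (by simpa using h1) h2
      rcases lt_or_ge (sideForm (-1) 0 (pathPos p q) q k (k + 1) v) 0 with h5 | h5
      · obtain ⟨t, ht, h⟩ := hC k v hk hkq hv h3 h4 h5
        exact ⟨_, .inl (.inr ⟨t, ht, rfl⟩), h⟩
      rcases lt_or_ge (sideForm 1 2 (pathPos p q) q k (k + 1) v) 0 with h6 | h6
      · obtain ⟨t, ht, h⟩ := hC' k v hk hkq hv h3 h4 h6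
        exact ⟨_, .inr ⟨t, ht, rfl⟩, h⟩
      rcases le_total 0 (sideForm 1 1 (pathPos p q) q k (k + 1) v) with h7 | h7
      · exact ⟨_, .inl (.inl (.inl ⟨k, ⟨hk, hkq⟩, rfl⟩)), mem_pathJoin_zero hk hkq h3 h4 h5 h7⟩
      · exact ⟨_, .inl (.inl (.inr ⟨k, ⟨hk, hkq⟩, rfl⟩)),
          mem_pathJoin_one hk hkq h3 h4 (neg_nonneg.2 h7) h6⟩
    · refine convexHull_min ?_ (convex_doubledHalf p q)
      rcases hA with ((⟨k, ⟨hk, hkq⟩, rfl⟩ | ⟨k, ⟨hk, hkq⟩, rfl⟩) | ⟨t, ht, rfl⟩) | ⟨t, ht, rfl⟩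
      · rintro v (rfl | rfl | rfl | rfl)
        · exact basePt_mem_doubledHalf hq (by omega) (by omega)
        · exact basePt_mem_doubledHalf hq (by omega) (by omega)
        · exact topPt_mem_doubledHalf hq (by omega) (by omega)
        · exact topPt_mem_doubledHalf hq (by omega) (by omega)
      · rintro v (rfl | rfl | rfl | rfl)
        · exact basePt_mem_doubledHalf hq (by omega) (by omega)
        · exact basePt_mem_doubledHalf hq (by omega) (by omega)
        · exact topPt_mem_doubledHalf hq (by omega) (by omega)
        · exact topPt_mem_doubledHalf hq (by omega) (by omega)
      · obtain ⟨h1, h2, h3, h4, -, -, -⟩ := hF t ht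
        rintro v (rfl | rfl | rfl | rfl)
        · exact basePt_mem_doubledHalf hq (by omega) (by omega)
        · exact topPt_mem_doubledHalf hq (by omega) (by omega)
        · exact topPt_mem_doubledHalf hq (by omega) (by omega)
        · exact topPt_mem_doubledHalf hq (by omega) (by omega)
      · obtain ⟨h1, h2, h3, h4, -, -, -⟩ := hF' t ht
        rintro v (rfl | rfl | rfl | rfl)
        · exact basePt_mem_doubledHalf hq (by omega) (by omega)
        · exact topPt_mem_doubledHalf hq (by omega) (by omega)
        · exact topPt_mem_doubledHalf hq (by omega) (by omega)
        · exact topPt_mem_doubledHalf hq (by omega) (by omega)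
  · have hsame : ∀ {ε α a b : ℤ} {G : Finset (ℤ × ℤ × ℤ)}, IsSide ε α → -1 ≤ a → b ≤ q + 1 →
        (∀ t ∈ G, IsChordTriangle (fun k => ε * pathPos p q k) q a b t) →
        (∀ t ∈ G, ∀ t' ∈ G, t = t' ∨ Precedes t t' ∨ Precedes t' t) → ∀ t ∈ G, ∀ t' ∈ G,
        MeetsInFace (pyramid α (pathPos p q) q t) (pyramid α (pathPos p q) q t') := by
      intro ε α a b G hs ha hb hG hGL t ht t' ht'
      rcases hGL t ht t' ht' with rfl | h | h
      · exact .of_subset subset_rfl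
      · exact pyramid_meets_pyramid hs ha hb (hG t ht) (hG t' ht') h
      · exact (pyramid_meets_pyramid hs ha hb (hG t' ht') (hG t ht) h).symm
    have hjoin : ∀ A ∈ cells p q F F', ∀ e k, 0 ≤ e → e ≤ 1 → 0 ≤ k → k < q →
        MeetsInFace A (pathJoin (pathPos p q) q e k) := by
      rintro A (((⟨k', ⟨hk, hkq⟩, rfl⟩ | ⟨k', ⟨hk, hkq⟩, rfl⟩) | ⟨t, ht, rfl⟩) | ⟨t, ht, rfl⟩)
        e k he he' hk' hkq'
      · exact pathJoin_meets_pathJoin le_rfl zero_le_one he he' hk hkq hk' hkq'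
      · exact pathJoin_meets_pathJoin zero_le_one le_rfl he he' hk hkq hk' hkq'
      · exact pyramid_meets_pathJoin hl (by omega) (by omega) (hF t ht) he he' hk' hkq'
      · exact pyramid_meets_pathJoin hr (by omega) (by omega) (hF' t ht) he he' hk' hkq'
    intro A hA B hB
    rcases id hB with ((⟨k, ⟨hk, hkq⟩, rfl⟩ | ⟨k, ⟨hk, hkq⟩, rfl⟩) | ⟨t, ht, rfl⟩) | ⟨t, ht, rfl⟩
    · exact hjoin A hA 0 k le_rfl zero_le_one hk hkq
    · exact hjoin A hA 1 k zero_le_one le_rfl hk hkq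
    all_goals
      rcases hA with
        ((⟨k, ⟨hk, hkq⟩, rfl⟩ | ⟨k, ⟨hk, hkq⟩, rfl⟩) | ⟨u, hu, rfl⟩) | ⟨u, hu, rfl⟩
    · exact (hjoin _ hB 0 k le_rfl zero_le_one hk hkq).symm
    · exact (hjoin _ hB 1 k zero_le_one le_rfl hk hkq).symm
    · exact hsame hl (by omega) (by omega) hF hL u hu t ht
    · exact (left_pyramid_meets_right_pyramid (hF t ht) (hF' u hu)).symm
    · exact (hjoin _ hB 0 k le_rfl zero_le_one hk hkq).symm
    · exact (hjoin _ hB 1 k zero_le_one le_rfl hk hkq).symm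
    · exact left_pyramid_meets_right_pyramid (hF u hu) (hF' t ht)
    · exact hsame hr (by omega) (by omega) hF' hL' u hu t ht

/-! ### The two halves of `T(p, q)` -/

theorem mem_Tpq_iff {p q : ℤ} (hq : 1 ≤ q) (v : Fin 3 → ℝ) :
    v ∈ Tpq p q ↔ 0 ≤ v 1 ∧ v 1 ≤ q * v 2 ∧ 0 ≤ q * v 0 - p * v 1 ∧
      q * v 0 - p * v 1 ≤ q * (1 - v 2) := by
  have hq0 : (0 : ℝ) < q := by exact_mod_cast hq
  constructor
  · intro hv
    have hconv : Convex ℝ {v : Fin 3 → ℝ | 0 ≤ v 1 ∧ v 1 ≤ q * v 2 ∧ 0 ≤ q * v 0 - p * v 1 ∧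
        q * v 0 - p * v 1 ≤ q * (1 - v 2)} := by
      rintro v ⟨h1, h2, h3, h4⟩ w ⟨h1', h2', h3', h4'⟩ s t hs ht hst
      obtain rfl : t = 1 - s := by linarith
      simp only [Set.mem_ofPred_eq, Pi.add_apply, Pi.smul_apply, smul_eq_mul]
      refine ⟨?_, ?_, ?_, ?_⟩
      · linarith [mul_nonneg hs h1, mul_nonneg ht h1']
      · linarith [mul_nonneg hs (sub_nonneg.2 h2), mul_nonneg ht (sub_nonneg.2 h2')]
      · linarith [mul_nonneg hs h3, mul_nonneg ht h3']
      · linarith [mul_nonneg hs (sub_nonneg.2 h4), mul_nonneg ht (sub_nonneg.2 h4')]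
    refine convexHull_min ?_ hconv hv
    rintro v (rfl | rfl | rfl | rfl)
    · simpa using hq0.le
    · simpa using hq0.le
    · simpa using hq0.le
    · simp
      exact ⟨by omega, by linarith, by linarith⟩
  · rintro ⟨h1, h2, h3, h4⟩
    refine mem_convexHull_four (1 - v 2 - (q * v 0 - p * v 1) / q) ((q * v 0 - p * v 1) / q)
      (v 2 - v 1 / q) (v 1 / q) ?_ (div_nonneg h3 hq0.le) ?_ (div_nonneg h1 hq0.le) (by ring) ?_
    · rw [sub_nonneg, div_le_iff₀ hq0]
      linarith
    · rw [sub_nonneg, div_le_iff₀ hq0]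
      linarith
    · intro i
      fin_cases i <;> simp <;> field_simp
      ring

theorem lowerHalf_eq {p q : ℤ} (hq : 1 ≤ q) :
    Tpq p q ∩ {x | x 2 ∈ Set.Icc (0 : ℝ) (1 / 2)} = (2 : ℝ)⁻¹ • doubledHalf p q := by
  ext v
  rw [Set.mem_inv_smul_set_iff₀ two_ne_zero, Set.mem_inter_iff, mem_Tpq_iff hq]
  simp only [doubledHalf, Set.mem_ofPred_eq, Set.mem_Icc, Pi.smul_apply, smul_eq_mul]
  constructor
  · rintro ⟨⟨h1, h2, h3, h4⟩, h5, h6⟩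
    exact ⟨by linarith, by linarith, by linarith, by linarith, by linarith, by linarith⟩
  · rintro ⟨h1, h2, h3, h4, h5, h6⟩
    exact ⟨⟨by linarith, by linarith, by linarith, by linarith⟩, by linarith, by linarith⟩

theorem hasGood_lowerHalf {p q : ℤ} (hq : 1 ≤ q) (hpq : IsCoprime p q) :
    HasGoodHalfUnimodularTriangulation (Tpq p q ∩ {x | x 2 ∈ Set.Icc (0 : ℝ) (1 / 2)}) := by
  rw [lowerHalf_eq hq]
  exact hasGood_half_doubledHalf hq hpq

/-- The upper half of `T(p, q)` is the image of the lower half of `T(p', q)`, where `p'` is inverse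
to `p` modulo `q`. -/
theorem upperHalf_eq {p q p' a : ℤ} (hq : 1 ≤ q) (h : p' * p + a * q = 1) :
    Tpq p q ∩ {x | x 2 ∈ Set.Icc (1 / 2 : ℝ) 1} =
      integralAffine !![p, a, 0; q, -p', 0; 0, 0, -1] ![0, 0, 1] ''
        (Tpq p' q ∩ {x | x 2 ∈ Set.Icc (0 : ℝ) (1 / 2)}) := by
  have h' : (p' : ℝ) * p + a * q = 1 := by exact_mod_cast h
  have hval : ∀ v : Fin 3 → ℝ, integralAffine !![p, a, 0; q, -p', 0; 0, 0, -1] ![0, 0, 1] v =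
      ![p * v 0 + a * v 1, q * v 0 - p' * v 1, 1 - v 2] := by
    intro v
    ext i
    fin_cases i <;>
      simp [integralAffine_apply, Matrix.mulVec, dotProduct, Fin.sum_univ_three] <;> ring
  have hmem : ∀ v : Fin 3 → ℝ, ![p * v 0 + a * v 1, q * v 0 - p' * v 1, 1 - v 2] ∈
      Tpq p q ∩ {x | x 2 ∈ Set.Icc (1 / 2 : ℝ) 1} ↔
      v ∈ Tpq p' q ∩ {x | x 2 ∈ Set.Icc (0 : ℝ) (1 / 2)} := by
    intro v
    have hform : q * (p * v 0 + a * v 1) - p * (q * v 0 - p' * v 1) = v 1 := by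
      linear_combination v 1 * h'
    rw [Set.mem_inter_iff, Set.mem_inter_iff, mem_Tpq_iff hq, mem_Tpq_iff hq]
    simp only [Set.mem_ofPred_eq, Set.mem_Icc, Matrix.cons_val, hform]
    constructor
    · rintro ⟨⟨h1, h2, h3, h4⟩, h5, h6⟩
      exact ⟨⟨by linarith, by linarith, by linarith, by linarith⟩, by linarith, by linarith⟩
    · rintro ⟨⟨h1, h2, h3, h4⟩, h5, h6⟩
      exact ⟨⟨by linarith, by linarith, by linarith, by linarith⟩, by linarith, by linarith⟩
  ext v
  constructor
  · intro hv
    have hv' : v = ![p * ![p' * v 0 + a * v 1, q * v 0 - p * v 1, 1 - v 2] 0 +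
        a * ![p' * v 0 + a * v 1, q * v 0 - p * v 1, 1 - v 2] 1,
        q * ![p' * v 0 + a * v 1, q * v 0 - p * v 1, 1 - v 2] 0 -
        p' * ![p' * v 0 + a * v 1, q * v 0 - p * v 1, 1 - v 2] 1,
        1 - ![p' * v 0 + a * v 1, q * v 0 - p * v 1, 1 - v 2] 2] := by
      ext i
      fin_cases i <;> simp
      · linear_combination -v 0 * h'
      · linear_combination -v 1 * h'
    refine ⟨![p' * v 0 + a * v 1, q * v 0 - p * v 1, 1 - v 2], (hmem _).1 ?_, ?_⟩
    · rwa [← hv']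
    · rw [hval, ← hv']
  · rintro ⟨w, hw, rfl⟩
    rw [hval]
    exact (hmem w).2 hw

/-- Both halves `T⁻ = T ∩ (ℝ² × [0,½])` and `T⁺ = T ∩ (ℝ² × [½,1])` of the empty
tetrahedron `T = T(p,q)` admit half-unimodular triangulations in which every tetrahedron
has an integer vertex. -/
theorem halves_have_halfUnimodular_triangulations (p q : ℤ) (hq : 1 ≤ q)
    (hpq : Int.gcd p q = 1) :
    HasGoodHalfUnimodularTriangulation (Tpq p q ∩ {x | x 2 ∈ Set.Icc (0 : ℝ) (1 / 2)}) ∧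
    HasGoodHalfUnimodularTriangulation (Tpq p q ∩ {x | x 2 ∈ Set.Icc (1 / 2 : ℝ) 1}) := by
  have hcop : IsCoprime p q := Int.isCoprime_iff_gcd_eq_one.2 hpq
  obtain ⟨p', a, h⟩ := id hcop
  refine ⟨hasGood_lowerHalf hq hcop, ?_⟩
  rw [upperHalf_eq hq h]
  refine (hasGood_lowerHalf hq ⟨p, a, by linarith⟩).image ?_ _
  rw [Int.isUnit_iff]
  left
  simp [Matrix.det_fin_three]
  linear_combination h
end
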